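/- arXiv:1409.2913 — 2 statements merged into one kernel-verified Lean document; each statement's English description precedes it below -/
import Mathlib

section
/- Partial coloring via linear optimization: for every ε with 0 < ε < ((1 − √(2/π))/32)⁴ there exists δ > 0 such that for any symmetric convex body K ⊂ ℝⁿ with γ_n(K) ≥ e^{−εn}, if Γ is a standard Gaussian vector and x is the maximizer of ⟨Γ, y⟩ over y ∈ K ∩ [−1,1]ⁿ, then with probability at least 1/2 at least δn coordinates of x satisfy |x_i| = 1. -/
open MeasureTheory Real
open scoped RealInnerProductSpace Pointwise

/-- The standard Gaussian measure on `ℝⁿ`. -/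
noncomputable def gauss (n : ℕ) : Measure (EuclideanSpace ℝ (Fin n)) :=
  volume.withDensity (fun x => ENNReal.ofReal ((2 * π) ^ (-(n : ℝ) / 2) * Real.exp (-‖x‖ ^ 2 / 2)))

/-- The Gaussian mean-width `w(K) = E[sup_{x ∈ K} ⟨Γ, x⟩]` of a set `K ⊆ ℝⁿ`. -/
noncomputable def meanWidth (n : ℕ) (K : Set (EuclideanSpace ℝ (Fin n))) : ℝ :=
  ∫ g, sSup ((fun x => ⟪g, x⟫) '' K) ∂(gauss n)


open ProbabilityTheory in
theorem gauss_lintegral_exp (n : ℕ) (b : ℝ) (hb : b < 1 / 2) :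
    ∫⁻ x, ENNReal.ofReal (Real.exp (b * ‖x‖ ^ 2)) ∂(gauss n)
      = ENNReal.ofReal ((1 / (1 - 2 * b)) ^ ((n : ℝ) / 2)) := by
  have hb2 : 0 < 1 / 2 - b := by linarith
  have hI := GaussianFourier.integral_rexp_neg_mul_sq_norm (V := EuclideanSpace ℝ (Fin n)) hb2
  have hintg : Integrable (fun v : EuclideanSpace ℝ (Fin n) => Real.exp (-(1 / 2 - b) * ‖v‖ ^ 2)) := by
    by_contra h
    rw [integral_undef h] at hI
    have : 0 < (π / (1 / 2 - b)) ^ ((Module.finrank ℝ (EuclideanSpace ℝ (Fin n)) : ℝ) / 2) := by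
      positivity
    linarith
  unfold gauss
  rw [lintegral_withDensity_eq_lintegral_mul _ (by fun_prop) (by fun_prop)]
  have : ∀ x : EuclideanSpace ℝ (Fin n),
      ENNReal.ofReal ((2 * π) ^ (-(n : ℝ) / 2) * Real.exp (-‖x‖ ^ 2 / 2)) *
        ENNReal.ofReal (Real.exp (b * ‖x‖ ^ 2)) =
      ENNReal.ofReal ((2 * π) ^ (-(n : ℝ) / 2) * Real.exp (-(1 / 2 - b) * ‖x‖ ^ 2)) := by
    intro x
    rw [← ENNReal.ofReal_mul (by positivity), mul_assoc, ← Real.exp_add]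
    congr 3
    ring
  simp only [Pi.mul_apply, this]
  rw [← ofReal_integral_eq_lintegral_ofReal (hintg.const_mul _)
    (Filter.Eventually.of_forall fun x => by positivity), integral_const_mul, hI]
  congr 1
  rw [finrank_euclideanSpace_fin, neg_div, Real.rpow_neg (by positivity), ← Real.inv_rpow (by positivity),
    ← Real.mul_rpow (by positivity) (by positivity)]
  congr 1
  have : 1 - 2 * b ≠ 0 := by linarith
  have h2 : 1 / 2 - b ≠ 0 := by linarith
  have hpi := Real.pi_ne_zero
  field_simp

instance gauss_prob (n : ℕ) : IsProbabilityMeasure (gauss n) := by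
  constructor
  have := gauss_lintegral_exp n 0 (by norm_num)
  simpa using this

open ProbabilityTheory in
theorem gauss_eq (n : ℕ) : gauss n = stdGaussian (EuclideanSpace ℝ (Fin n)) := by
  apply Measure.ext_of_charFun
  ext t
  rw [charFun_stdGaussian, charFun_apply]
  unfold gauss
  rw [integral_withDensity_eq_integral_toReal_smul (by fun_prop) (by simp)]
  have h1 : ∀ x : EuclideanSpace ℝ (Fin n),
      (ENNReal.ofReal ((2 * π) ^ (-(n : ℝ) / 2) * Real.exp (-‖x‖ ^ 2 / 2))).toReal •
        Complex.exp (⟪x, t⟫ * Complex.I) =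
      (((2 * π) ^ (-(n : ℝ) / 2) : ℝ) : ℂ) *
        Complex.exp (-(1 / 2 : ℂ) * ‖x‖ ^ 2 + Complex.I * ⟪t, x⟫) := by
    intro x
    rw [ENNReal.toReal_ofReal (by positivity), Complex.real_smul, Complex.exp_add]
    push_cast
    rw [real_inner_comm x t, mul_comm Complex.I]
    rw [mul_assoc]
    congr 3
    ring
  simp only [h1]
  rw [integral_const_mul, GaussianFourier.integral_cexp_neg_mul_sq_norm_add (by norm_num),
    ← mul_assoc]
  have h2 : (((2 * π) ^ (-(n : ℝ) / 2) : ℝ) : ℂ) *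
      (π / (1 / 2 : ℂ)) ^ ((Module.finrank ℝ (EuclideanSpace ℝ (Fin n)) : ℂ) / 2) = 1 := by
    have : (π / (1 / 2 : ℂ)) ^ ((Module.finrank ℝ (EuclideanSpace ℝ (Fin n)) : ℂ) / 2)
       = (((2 * π) ^ ((n : ℝ) / 2) : ℝ) : ℂ) := by
      rw [Complex.ofReal_cpow (by positivity)]
      push_cast
      rw [finrank_euclideanSpace_fin]
      congr 1
      ring
    rw [this, ← Complex.ofReal_mul, ← Real.rpow_add (by positivity)]
    simp [neg_div]
  rw [h2, one_mul]
  congr 1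
  rw [Complex.I_sq]
  ring

open ProbabilityTheory in
theorem gauss_eq_map (n : ℕ) : gauss n =
    (Measure.pi (fun _ : Fin n => gaussianReal 0 1)).map (WithLp.toLp 2) := by
  rw [gauss_eq, map_pi_eq_stdGaussian]

open ProbabilityTheory in
theorem gauss_map_inner (n : ℕ) (u : EuclideanSpace ℝ (Fin n)) :
    (gauss n).map (fun w => ⟪u, w⟫) = gaussianReal 0 (‖u‖₊ ^ 2) := by
  have h := IsGaussian.map_eq_gaussianReal (μ := stdGaussian (EuclideanSpace ℝ (Fin n)))
    (innerSL ℝ u)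
  rw [gauss_eq]
  rw [integral_strongDual_stdGaussian, variance_dual_stdGaussian] at h
  convert h using 2
  · ext w
    simp
  · rw [innerSL_apply_norm]
    ext
    simp

open ProbabilityTheory in
theorem gauss_tail (n : ℕ) (u : EuclideanSpace ℝ (Fin n)) (hu : ‖u‖ ≤ 1) (a : ℝ) (ha : 0 ≤ a) :
    (gauss n).real {w | a ≤ ⟪u, w⟫} ≤ Real.exp (-a ^ 2 / 2) := by
  have hm := mgf_gaussianReal (gauss_map_inner n u) a
  have := measure_ge_le_exp_mul_mgf (μ := gauss n) (X := fun w => ⟪u, w⟫) (t := a) a ha (by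
    by_contra h
    have h0 : mgf (fun w => ⟪u, w⟫) (gauss n) a = 0 := integral_undef h
    rw [h0] at hm
    have := Real.exp_pos (0 * a + (‖u‖₊ ^ 2 : NNReal) * a ^ 2 / 2)
    linarith)
  refine this.trans ?_
  rw [hm, ← Real.exp_add]
  apply Real.exp_le_exp.2
  have : ‖u‖ ^ 2 ≤ 1 := by nlinarith [norm_nonneg u]
  have e : ((‖u‖₊ ^ 2 : NNReal) : ℝ) = ‖u‖ ^ 2 := by simp
  rw [e]
  nlinarith [sq_nonneg a]

theorem gauss_norm_tail (n : ℕ) :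
    (gauss n).real {x | 2 * √n < ‖x‖} ≤ Real.exp (-n / 2) := by
  have h := gauss_lintegral_exp n (1 / 4) (by norm_num)
  have hm := mul_meas_ge_le_lintegral₀ (μ := gauss n)
    (f := fun x => ENNReal.ofReal (Real.exp (1 / 4 * ‖x‖ ^ 2))) (by fun_prop)
    (ENNReal.ofReal (Real.exp n))
  rw [h] at hm
  have hsub : {x : EuclideanSpace ℝ (Fin n) | 2 * √n < ‖x‖} ⊆
      {x | ENNReal.ofReal (Real.exp n) ≤ ENNReal.ofReal (Real.exp (1 / 4 * ‖x‖ ^ 2))} := by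
    intro x hx
    simp only [Set.mem_ofPred_eq] at hx ⊢
    apply ENNReal.ofReal_le_ofReal
    apply Real.exp_le_exp.2
    have h1 : √(n : ℝ) ^ 2 = n := Real.sq_sqrt (by positivity)
    have h2 := Real.sqrt_nonneg (n : ℝ)
    nlinarith
  have h3 : ENNReal.ofReal (Real.exp n) * gauss n {x | 2 * √n < ‖x‖} ≤
      ENNReal.ofReal ((1 / (1 - 2 * (1 / 4))) ^ ((n : ℝ) / 2)) :=
    (mul_le_mul_right (measure_mono hsub) _).trans hm
  have h4 : Real.exp n * (gauss n).real {x | 2 * √n < ‖x‖} ≤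
      (1 / (1 - 2 * (1 / 4))) ^ ((n : ℝ) / 2) := by
    have := ENNReal.toReal_mono (by simp) h3
    rwa [ENNReal.toReal_mul, ENNReal.toReal_ofReal (by positivity),
      ENNReal.toReal_ofReal (by apply Real.rpow_nonneg; norm_num)] at this
  have h5 : ((1 : ℝ) / (1 - 2 * (1 / 4))) ^ ((n : ℝ) / 2) ≤ Real.exp (n / 2) := by
    rw [← Real.exp_one_rpow]
    apply Real.rpow_le_rpow (by norm_num) _ (by positivity)
    have := Real.add_one_le_exp (1 : ℝ)
    norm_num at this ⊢
    linarith
  have h6 : Real.exp n * Real.exp (-n / 2) = Real.exp (n / 2) := by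
    rw [← Real.exp_add]; congr 1; ring
  nlinarith [Real.exp_pos n]


theorem infDist_subgrad {n : ℕ} (A : Set (EuclideanSpace ℝ (Fin n))) (hA : Convex ℝ A)
    (hc : IsClosed A) (hne : A.Nonempty) (Z : EuclideanSpace ℝ (Fin n)) :
    ∃ u : EuclideanSpace ℝ (Fin n), ‖u‖ ≤ 1 ∧
      ∀ y, Metric.infDist Z A - Metric.infDist y A ≤ ⟪u, Z - y⟫ := by
  by_cases hZ : Z ∈ A
  · refine ⟨0, by simp, fun y => ?_⟩
    rw [Metric.infDist_zero_of_mem hZ]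
    simp [Metric.infDist_nonneg]
  obtain ⟨P, hP, hPm⟩ := exists_norm_eq_iInf_of_complete_convex hne hc.isComplete hA Z
  have hin := (norm_eq_iInf_iff_real_inner_le_zero hA hP).1 hPm
  have hne0 : Z - P ≠ 0 := by
    intro h
    rw [sub_eq_zero] at h
    exact hZ (h ▸ hP)
  have hpos : 0 < ‖Z - P‖ := norm_pos_iff.2 hne0
  refine ⟨‖Z - P‖⁻¹ • (Z - P), ?_, fun y => ?_⟩
  · rw [norm_smul, norm_inv, norm_norm, inv_mul_cancel₀ hpos.ne']
  have h1 : Metric.infDist Z A ≤ ‖Z - P‖ := by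
    rw [← dist_eq_norm]; exact Metric.infDist_le_dist_of_mem hP
  set u := ‖Z - P‖⁻¹ • (Z - P) with hu
  have hun : ‖u‖ = 1 := by
    rw [hu, norm_smul, norm_inv, norm_norm, inv_mul_cancel₀ hpos.ne']
  have h2 : ‖Z - P‖ - ⟪u, Z - y⟫ ≤ Metric.infDist y A := by
    rw [Metric.le_infDist hne]
    intro w hw
    rw [dist_eq_norm]
    have a1 : ⟪u, y - w⟫ ≤ ‖y - w‖ := by
      have := real_inner_le_norm u (y - w)
      rwa [hun, one_mul] at this
    have a2 : ⟪u, y - w⟫ = - ⟪u, Z - y⟫ + ⟪u, Z - P⟫ - ⟪u, w - P⟫ := by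
      rw [← inner_neg_right, ← inner_add_right, ← inner_sub_right]
      congr 1
      abel
    have a3 : ⟪u, Z - P⟫ = ‖Z - P‖ := by
      rw [hu, real_inner_smul_left, real_inner_self_eq_norm_sq]
      field_simp
    have a4 : ⟪u, w - P⟫ ≤ 0 := by
      rw [hu, real_inner_smul_left]
      exact mul_nonpos_of_nonneg_of_nonpos (by positivity) (hin w hw)
    linarith
  linarith

theorem conc_section {n : ℕ} (A : Set (EuclideanSpace ℝ (Fin n))) (hA : Convex ℝ A)
    (hc : IsClosed A) (hne : A.Nonempty) (Z : EuclideanSpace ℝ (Fin n)) (hZ : ‖Z‖ ≤ 2 * √n) :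
    gauss n {W | 0.00015 * √n ≤ Metric.infDist Z A -
      Metric.infDist (Real.cos (π / 400) • Z - Real.sin (π / 400) • W) A} ≤
      ENNReal.ofReal (Real.exp (-0.00005 * n)) := by
  obtain ⟨u, hu, hsub⟩ := infDist_subgrad A hA hc hne Z
  have ht := gauss_tail n u hu (0.01 * √n) (by positivity)
  have hs : √(n : ℝ) ^ 2 = n := Real.sq_sqrt (by positivity)
  have he : -(0.01 * √(n : ℝ)) ^ 2 / 2 = -0.00005 * n := by
    rw [mul_pow, hs]; ring
  rw [he] at ht
  have ht' : gauss n {w | 0.01 * √n ≤ ⟪u, w⟫} ≤ ENNReal.ofReal (Real.exp (-0.00005 * n)) := by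
    rw [← ofReal_measureReal]
    exact ENNReal.ofReal_le_ofReal ht
  refine (measure_mono ?_).trans ht'
  intro W hW
  simp only [Set.mem_ofPred_eq] at hW ⊢
  by_contra hlt
  push Not at hlt
  have h1 := hsub (Real.cos (π / 400) • Z - Real.sin (π / 400) • W)
  have h2 : Z - (Real.cos (π / 400) • Z - Real.sin (π / 400) • W) =
      (1 - Real.cos (π / 400)) • Z + Real.sin (π / 400) • W := by
    rw [sub_smul, one_smul]; abel
  rw [h2, inner_add_right, real_inner_smul_right, real_inner_smul_right] at h1
  have hp1 := Real.pi_gt_three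
  have hp2 := Real.pi_lt_d2
  have hsin : 0 < Real.sin (π / 400) := Real.sin_pos_of_pos_of_lt_pi (by linarith) (by linarith)
  have hsin2 : Real.sin (π / 400) ≤ π / 400 := Real.sin_le (by linarith)
  have hcos := Real.one_sub_sq_div_two_le_cos (x := π / 400)
  have hcos1 := Real.cos_le_one (π / 400)
  have hq := Real.sqrt_nonneg (n : ℝ)
  have h3 : ⟪u, Z⟫ ≤ 2 * √n := by
    have := real_inner_le_norm u Z
    nlinarith [norm_nonneg u, norm_nonneg Z]
  have h4 : (1 - Real.cos (π / 400)) * ⟪u, Z⟫ ≤ 0.0000625 * √n := by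
    have : 1 - Real.cos (π / 400) ≤ 0.00003125 := by nlinarith
    calc (1 - Real.cos (π / 400)) * ⟪u, Z⟫ ≤ (1 - Real.cos (π / 400)) * (2 * √n) :=
          mul_le_mul_of_nonneg_left h3 (by linarith)
      _ ≤ 0.00003125 * (2 * √n) := mul_le_mul_of_nonneg_right this (by linarith)
      _ = _ := by ring
  have h5 : Real.sin (π / 400) * ⟪u, W⟫ < Real.sin (π / 400) * (0.01 * √n) :=
    mul_lt_mul_of_pos_left hlt hsin
  have h6 : Real.sin (π / 400) * (0.01 * √n) ≤ 0.008 * (0.01 * √n) :=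
    mul_le_mul_of_nonneg_right (by linarith) (by positivity)
  linarith

open ProbabilityTheory in
theorem conc_step {n : ℕ} (A : Set (EuclideanSpace ℝ (Fin n))) (hA : Convex ℝ A)
    (hc : IsClosed A) (hne : A.Nonempty) (θ : ℝ) :
    ((gauss n).prod (gauss n)) {p | 0.00015 * √n ≤
      Metric.infDist (Real.cos θ • p.1 + Real.sin θ • p.2) A -
      Metric.infDist (Real.cos (θ - π / 400) • p.1 + Real.sin (θ - π / 400) • p.2) A} ≤
      ENNReal.ofReal (2 * Real.exp (-0.00005 * n)) := by
  set T : Set (EuclideanSpace ℝ (Fin n) × EuclideanSpace ℝ (Fin n)) :=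
    {q | 0.00015 * √n ≤ Metric.infDist q.1 A -
      Metric.infDist (Real.cos (π / 400) • q.1 - Real.sin (π / 400) • q.2) A} with hT
  have hTm : MeasurableSet T := by
    apply IsClosed.measurableSet
    have h1 : Continuous fun q : EuclideanSpace ℝ (Fin n) × EuclideanSpace ℝ (Fin n) =>
        Metric.infDist q.1 A := (Metric.continuous_infDist_pt A).comp continuous_fst
    have h2 : Continuous fun q : EuclideanSpace ℝ (Fin n) × EuclideanSpace ℝ (Fin n) =>
        Metric.infDist (Real.cos (π / 400) • q.1 - Real.sin (π / 400) • q.2) A :=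
      (Metric.continuous_infDist_pt A).comp (by fun_prop)
    exact isClosed_le continuous_const (h1.sub h2)
  have hrot : ((gauss n).prod (gauss n)).map (ContinuousLinearMap.rotation θ) =
      (gauss n).prod (gauss n) := by
    rw [gauss_eq]
    exact IsGaussian.map_rotation_eq_self (by simp) θ
  have hpre : {p : EuclideanSpace ℝ (Fin n) × EuclideanSpace ℝ (Fin n) | 0.00015 * √n ≤
      Metric.infDist (Real.cos θ • p.1 + Real.sin θ • p.2) A -
      Metric.infDist (Real.cos (θ - π / 400) • p.1 + Real.sin (θ - π / 400) • p.2) A} =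
      (ContinuousLinearMap.rotation θ) ⁻¹' T := by
    ext p
    simp only [hT, Set.mem_preimage, Set.mem_ofPred_eq, ContinuousLinearMap.rotation_apply]
    have : Real.cos (θ - π / 400) • p.1 + Real.sin (θ - π / 400) • p.2 =
        Real.cos (π / 400) • (Real.cos θ • p.1 + Real.sin θ • p.2) -
        Real.sin (π / 400) • (-Real.sin θ • p.1 + Real.cos θ • p.2) := by
      rw [Real.cos_sub, Real.sin_sub]
      module
    rw [this]
  rw [hpre, ← Measure.map_apply (by fun_prop) hTm, hrot]
  set B : Set (EuclideanSpace ℝ (Fin n)) := {x | 2 * √n < ‖x‖} with hB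
  have hBm : MeasurableSet B := (isOpen_lt continuous_const continuous_norm).measurableSet
  have hsplit : T ⊆ (B ×ˢ Set.univ) ∪ (T ∩ (Bᶜ ×ˢ Set.univ)) := by
    intro q hq
    by_cases h : q.1 ∈ B
    · left; exact ⟨h, trivial⟩
    · right; exact ⟨hq, h, trivial⟩
  refine (measure_mono hsplit).trans ((measure_union_le _ _).trans ?_)
  have e1 : ((gauss n).prod (gauss n)) (B ×ˢ Set.univ) ≤
      ENNReal.ofReal (Real.exp (-0.00005 * n)) := by
    rw [Measure.prod_prod, measure_univ, mul_one, ← ofReal_measureReal]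
    apply ENNReal.ofReal_le_ofReal
    refine (gauss_norm_tail n).trans (Real.exp_le_exp.2 ?_)
    have : (0 : ℝ) ≤ n := by positivity
    linarith
  have e2 : ((gauss n).prod (gauss n)) (T ∩ (Bᶜ ×ˢ Set.univ)) ≤
      ENNReal.ofReal (Real.exp (-0.00005 * n)) := by
    rw [Measure.prod_apply (hTm.inter (hBm.compl.prod MeasurableSet.univ))]
    calc _ ≤ ∫⁻ _ : EuclideanSpace ℝ (Fin n), ENNReal.ofReal (Real.exp (-0.00005 * n)) ∂(gauss n) := by
          apply lintegral_mono
          intro Z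
          by_cases hZ : Z ∈ B
          · have : Prod.mk Z ⁻¹' (T ∩ (Bᶜ ×ˢ Set.univ)) = ∅ := by
              ext W; simp [hZ]
            simp [this]
          · refine (measure_mono ?_).trans (conc_section A hA hc hne Z ?_)
            · intro W hW
              exact hW.1
            · simpa [hB] using hZ
      _ = _ := by simp
  calc _ ≤ _ := add_le_add e1 e2
    _ = _ := by
      rw [← ENNReal.ofReal_add (by positivity) (by positivity)]
      congr 1
      ring

theorem conc {n : ℕ} (A : Set (EuclideanSpace ℝ (Fin n))) (hA : Convex ℝ A)
    (hc : IsClosed A) (hne : A.Nonempty) :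
    gauss n A * gauss n {x | 0.03 * √n ≤ Metric.infDist x A} ≤
      ENNReal.ofReal (400 * Real.exp (-0.00005 * n)) := by
  rw [← Measure.prod_prod]
  have hsub : A ×ˢ {x | 0.03 * √n ≤ Metric.infDist x A} ⊆
      ⋃ k ∈ Finset.range 200, {p : EuclideanSpace ℝ (Fin n) × EuclideanSpace ℝ (Fin n) |
        0.00015 * √n ≤
        Metric.infDist (Real.cos ((k + 1 : ℕ) * (π / 400)) • p.1 +
          Real.sin ((k + 1 : ℕ) * (π / 400)) • p.2) A -
        Metric.infDist (Real.cos ((k + 1 : ℕ) * (π / 400) - π / 400) • p.1 +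
          Real.sin ((k + 1 : ℕ) * (π / 400) - π / 400) • p.2) A} := by
    rintro ⟨x, y⟩ ⟨hx, hy⟩
    simp only [Set.mem_ofPred_eq] at hx hy
    by_contra hcon
    simp only [Set.mem_iUnion, Set.mem_ofPred_eq, not_exists, not_le] at hcon
    set F : ℕ → ℝ := fun k => Metric.infDist (Real.cos (k * (π / 400)) • x +
          Real.sin (k * (π / 400)) • y) A with hF
    have hlt : ∀ k ∈ Finset.range 200, F (k + 1) - F k < 0.00015 * √n := by
      intro k hk
      have := hcon k hk
      have e : ((k + 1 : ℕ) : ℝ) * (π / 400) - π / 400 = k * (π / 400) := by push_cast; ring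
      rw [e] at this
      exact this
    have hsum := Finset.sum_lt_sum_of_nonempty (s := Finset.range 200) (by simp) hlt
    rw [Finset.sum_range_sub F 200] at hsum
    have f0 : F 0 = 0 := by
      simp [hF, Metric.infDist_zero_of_mem hx]
    have f1 : F 200 = Metric.infDist y A := by
      have : ((200 : ℕ) : ℝ) * (π / 400) = π / 2 := by push_cast; ring
      simp only [hF, this]
      simp
    rw [f0, f1] at hsum
    simp at hsum
    linarith
  refine (measure_mono hsub).trans ((measure_biUnion_finset_le _ _).trans ?_)
  refine (Finset.sum_le_sum fun k _ => conc_step A hA hc hne _).trans ?_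
  rw [Finset.sum_const, Finset.card_range, nsmul_eq_mul, ← ENNReal.ofReal_natCast,
    ← ENNReal.ofReal_mul (by positivity)]
  apply ENNReal.ofReal_le_ofReal
  apply le_of_eq
  push_cast
  ring


/-- Vector with coordinates of `s` on `I` and coordinates of `y` off `I`. -/
noncomputable def mergeVec {n : ℕ} (I : Finset (Fin n)) (s y : EuclideanSpace ℝ (Fin n)) :
    EuclideanSpace ℝ (Fin n) :=
  WithLp.toLp 2 (fun i => if i ∈ I then s i else y i)

theorem mergeVec_apply {n : ℕ} (I : Finset (Fin n)) (s y : EuclideanSpace ℝ (Fin n)) (i : Fin n) :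
    mergeVec I s y i = if i ∈ I then s i else y i := rfl

theorem mergeVec_continuous {n : ℕ} (I : Finset (Fin n)) :
    Continuous (fun p : EuclideanSpace ℝ (Fin n) × EuclideanSpace ℝ (Fin n) =>
      mergeVec I p.1 p.2) := by
  unfold mergeVec
  apply (PiLp.continuous_toLp 2 _).comp
  apply continuous_pi
  intro i
  by_cases h : i ∈ I
  · simp only [h, if_true]; fun_prop
  · simp only [h, if_false]; fun_prop

open ProbabilityTheory in
theorem gauss_merge {n : ℕ} (I : Finset (Fin n)) :
    ((gauss n).prod (gauss n)).map (fun p => mergeVec I p.1 p.2) = gauss n := by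
  have hpi : Measure.pi (fun _ : Fin n => gaussianReal 0 1) =
      ((Measure.pi (fun _ : Fin n => gaussianReal 0 1)).prod
        (Measure.pi (fun _ : Fin n => gaussianReal 0 1))).map
        (fun p i => if i ∈ I then p.1 i else p.2 i) := by
    have hmeas : Measurable (fun (p : (Fin n → ℝ) × (Fin n → ℝ)) (i : Fin n) =>
        if i ∈ I then p.1 i else p.2 i) := by
      apply measurable_pi_lambda
      intro i
      by_cases h : i ∈ I
      · simp only [h, if_true]; fun_prop
      · simp only [h, if_false]; fun_prop
    apply Measure.pi_eq
    intro S hS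
    rw [Measure.map_apply hmeas (MeasurableSet.univ_pi hS)]
    have : (fun (p : (Fin n → ℝ) × (Fin n → ℝ)) (i : Fin n) =>
        if i ∈ I then p.1 i else p.2 i) ⁻¹' (Set.univ.pi S) =
        (Set.univ.pi (fun i => if i ∈ I then S i else Set.univ)) ×ˢ
        (Set.univ.pi (fun i => if i ∈ I then Set.univ else S i)) := by
      ext p
      simp only [Set.mem_preimage, Set.mem_pi, Set.mem_univ, true_imp_iff, Set.mem_prod]
      constructor
      · intro h
        refine ⟨fun i => ?_, fun i => ?_⟩ <;> have := h i <;> by_cases hi : i ∈ I <;> simp_all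
      · rintro ⟨h1, h2⟩ i
        have := h1 i
        have := h2 i
        by_cases hi : i ∈ I <;> simp_all
    rw [this, Measure.prod_prod, Measure.pi_pi, Measure.pi_pi, ← Finset.prod_mul_distrib]
    apply Finset.prod_congr rfl
    intro i _
    by_cases hi : i ∈ I <;> simp [hi]
  have hm : Measurable (WithLp.toLp 2 : (Fin n → ℝ) → EuclideanSpace ℝ (Fin n)) :=
    (PiLp.continuous_toLp 2 _).measurable
  conv_rhs => rw [gauss_eq_map, hpi]
  conv_lhs => rw [gauss_eq_map]
  rw [Measure.map_prod_map _ _ hm hm, Measure.map_map (mergeVec_continuous I).measurable (hm.prodMap hm),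
    Measure.map_map hm]
  · rfl
  · apply measurable_pi_lambda
    intro i
    by_cases h : i ∈ I
    · simp only [h, if_true]; fun_prop
    · simp only [h, if_false]; fun_prop

theorem exists_section {n : ℕ} (I : Finset (Fin n)) (K : Set (EuclideanSpace ℝ (Fin n)))
    (hK : MeasurableSet K) : ∃ s, gauss n K ≤ gauss n {y | mergeVec I s y ∈ K} := by
  have h : gauss n K = ∫⁻ s, gauss n {y | mergeVec I s y ∈ K} ∂(gauss n) := by
    conv_lhs => rw [← gauss_merge I]
    rw [Measure.map_apply (mergeVec_continuous I).measurable hK,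
      Measure.prod_apply ((mergeVec_continuous I).measurable hK)]
    rfl
  rw [h]
  exact exists_lintegral_le (by rw [← h]; exact measure_ne_top _ _)

open ProbabilityTheory in
theorem gauss_neg {n : ℕ} (S : Set (EuclideanSpace ℝ (Fin n))) (hS : MeasurableSet S) :
    gauss n {x | -x ∈ S} = gauss n S := by
  have h := stdGaussian_map (LinearIsometryEquiv.neg ℝ (E := EuclideanSpace ℝ (Fin n)))
  rw [← gauss_eq] at h
  conv_rhs => rw [← h]
  rw [Measure.map_apply (LinearIsometryEquiv.continuous _).measurable hS]
  rfl

theorem conc_section0 {n : ℕ} (I : Finset (Fin n)) (K : Set (EuclideanSpace ℝ (Fin n)))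
    (hconv : Convex ℝ K) (hsymm : K = -K) (hcl : IsClosed K) :
    gauss n K * gauss n {x | 0.03 * √n ≤ Metric.infDist x {y | mergeVec I 0 y ∈ K}} ≤
      ENNReal.ofReal (800 * Real.exp (-0.00005 * n)) := by
  obtain ⟨s, hs⟩ := exists_section I K hcl.measurableSet
  set A := {y | mergeVec I s y ∈ K} with hA
  by_cases h0 : gauss n K = 0
  · simp [h0]
  have hAne : A.Nonempty := by
    rw [Set.nonempty_iff_ne_empty]
    intro h
    rw [h, measure_empty] at hs
    exact h0 (le_antisymm hs (by simp))
  have hAc : IsClosed A := hcl.preimage ((mergeVec_continuous I).comp (Continuous.prodMk_right s))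
  have hAconv : Convex ℝ A := by
    intro a ha b hb p q hp hq hpq
    have : mergeVec I s (p • a + q • b) = p • mergeVec I s a + q • mergeVec I s b := by
      ext i
      by_cases hi : i ∈ I
      · simp [mergeVec_apply, hi, ← add_mul, hpq]
      · simp [mergeVec_apply, hi]
    simp only [hA, Set.mem_ofPred_eq] at ha hb ⊢
    rw [this]
    exact hconv ha hb hp hq hpq
  set B := {x | 0.03 * √n ≤ Metric.infDist x A} with hB
  have hBm : MeasurableSet B :=
    (isClosed_le continuous_const (Metric.continuous_infDist_pt A)).measurableSet
  have hsub : {x | 0.03 * √n ≤ Metric.infDist x {y | mergeVec I 0 y ∈ K}} ⊆ B ∪ {x | -x ∈ B} := by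
    intro x hx
    by_contra hcon
    simp only [hB, Set.mem_union, Set.mem_ofPred_eq, not_or, not_le] at hcon hx
    obtain ⟨a, ha, hxa⟩ := (Metric.infDist_lt_iff hAne).1 hcon.1
    obtain ⟨b, hb, hxb⟩ := (Metric.infDist_lt_iff hAne).1 hcon.2
    have hmem : (1 / 2 : ℝ) • a + (1 / 2 : ℝ) • (-b) ∈ {y | mergeVec I 0 y ∈ K} := by
      simp only [Set.mem_ofPred_eq]
      have : mergeVec I 0 ((1 / 2 : ℝ) • a + (1 / 2 : ℝ) • (-b)) =
          (1 / 2 : ℝ) • mergeVec I s a + (1 / 2 : ℝ) • (-mergeVec I s b) := by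
        ext i
        by_cases hi : i ∈ I
        · simp [mergeVec_apply, hi]
        · simp [mergeVec_apply, hi]
      rw [this]
      refine hconv ha ?_ (by norm_num) (by norm_num) (by norm_num)
      rw [hsymm]
      simpa using (show mergeVec I s b ∈ K from hb)
    have h1 := Metric.infDist_le_dist_of_mem (x := x) hmem
    have h2 : dist x ((1 / 2 : ℝ) • a + (1 / 2 : ℝ) • (-b)) ≤ 1 / 2 * dist x a + 1 / 2 * dist (-x) b := by
      rw [dist_eq_norm, dist_eq_norm, dist_eq_norm]
      have : x - ((1 / 2 : ℝ) • a + (1 / 2 : ℝ) • (-b)) =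
          (1 / 2 : ℝ) • (x - a) - (1 / 2 : ℝ) • (-x - b) := by module
      rw [this]
      refine (norm_sub_le _ _).trans ?_
      rw [norm_smul, norm_smul]
      norm_num
    linarith
  have hc := conc A hAconv hAc hAne
  have hm : gauss n {x | 0.03 * √n ≤ Metric.infDist x {y | mergeVec I 0 y ∈ K}} ≤
      2 * gauss n B := by
    refine (measure_mono hsub).trans ((measure_union_le _ _).trans ?_)
    rw [gauss_neg B hBm, two_mul]
  calc _ ≤ gauss n A * (2 * gauss n B) := mul_le_mul' hs hm
    _ = 2 * (gauss n A * gauss n B) := by ring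
    _ ≤ 2 * ENNReal.ofReal (400 * Real.exp (-0.00005 * n)) := by gcongr
    _ = _ := by
      rw [← ENNReal.ofReal_ofNat 2, ← ENNReal.ofReal_mul (by norm_num)]
      congr 1
      ring


theorem inner_coord {n : ℕ} (g x : EuclideanSpace ℝ (Fin n)) : ⟪g, x⟫ = ∑ i, g i * x i := by
  rw [PiLp.inner_apply]
  apply Finset.sum_congr rfl
  intro i _
  simp [mul_comm]

theorem inner_le_l1 {n : ℕ} (g x : EuclideanSpace ℝ (Fin n)) (hx : ∀ i, |x i| ≤ 1) :
    ⟪g, x⟫ ≤ ∑ i, |g i| := by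
  rw [inner_coord]
  apply Finset.sum_le_sum
  intro i _
  calc g i * x i ≤ |g i * x i| := le_abs_self _
    _ = |g i| * |x i| := abs_mul _ _
    _ ≤ |g i| * 1 := mul_le_mul_of_nonneg_left (hx i) (abs_nonneg _)
    _ = _ := mul_one _

theorem local_max {n : ℕ} (K : Set (EuclideanSpace ℝ (Fin n))) (hconv : Convex ℝ K)
    (g x y : EuclideanSpace ℝ (Fin n)) (hx : x ∈ K ∩ {y | ∀ i, |y i| ≤ 1})
    (hmax : IsMaxOn (fun y => ⟪g, y⟫) (K ∩ {y | ∀ i, |y i| ≤ 1}) x)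
    (hy : y ∈ K) (hyI : ∀ i, |x i| = 1 → |y i| ≤ 1) : ⟪g, y⟫ ≤ ⟪g, x⟫ := by
  have hev : ∀ᶠ θ : ℝ in nhdsWithin 0 (Set.Ioi 0), ∀ i, |x i + θ * (y i - x i)| ≤ 1 := by
    rw [Filter.eventually_all]
    intro i
    by_cases hi : |x i| = 1
    · have h1 : ∀ᶠ θ : ℝ in nhdsWithin 0 (Set.Ioi 0), θ < 1 :=
        nhdsWithin_le_nhds (eventually_lt_nhds (by norm_num))
      filter_upwards [h1, self_mem_nhdsWithin] with θ hθ hθ0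
      have hθ0 : 0 < θ := hθ0
      have hyi := abs_le.1 (hyI i hi)
      have hxi := abs_le.1 hi.le
      rw [abs_le]
      constructor <;> nlinarith
    · have hlt : |x i| < 1 := lt_of_le_of_ne (hx.2 i) hi
      have hcont : Filter.Tendsto (fun θ : ℝ => |x i + θ * (y i - x i)|) (nhds 0)
          (nhds |x i + 0 * (y i - x i)|) :=
        Continuous.tendsto (by fun_prop) 0
      rw [zero_mul, add_zero] at hcont
      have := hcont.eventually (eventually_lt_nhds hlt)
      exact nhdsWithin_le_nhds (this.mono fun θ h => h.le)
  have h1 : ∀ᶠ θ : ℝ in nhdsWithin 0 (Set.Ioi 0), θ < 1 :=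
    nhdsWithin_le_nhds (eventually_lt_nhds (by norm_num))
  have hpos : ∀ᶠ θ : ℝ in nhdsWithin 0 (Set.Ioi 0), 0 < θ := self_mem_nhdsWithin
  obtain ⟨θ, hθ, hθ1, hθ0⟩ := (hev.and (h1.and hpos)).exists
  have hmem : x + θ • (y - x) ∈ K ∩ {y | ∀ i, |y i| ≤ 1} := by
    refine ⟨?_, ?_⟩
    · have := hconv hx.1 hy (a := 1 - θ) (b := θ) (by linarith) hθ0.le (by ring)
      convert this using 1
      module
    · intro i
      simpa using hθ i
  have h2 : ⟪g, x + θ • (y - x)⟫ ≤ ⟪g, x⟫ := hmax hmem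
  rw [inner_add_right, real_inner_smul_right, inner_sub_right] at h2
  nlinarith

theorem det_large {n : ℕ} (K : Set (EuclideanSpace ℝ (Fin n))) (hconv : Convex ℝ K)
    (g x : EuclideanSpace ℝ (Fin n)) (hx : x ∈ K ∩ {y | ∀ i, |y i| ≤ 1})
    (hmax : IsMaxOn (fun y => ⟪g, y⟫) (K ∩ {y | ∀ i, |y i| ≤ 1}) x)
    (I : Finset (Fin n)) (hI : ∀ i, |x i| = 1 → i ∈ I)
    (hne : {y | mergeVec I 0 y ∈ K}.Nonempty) (t : ℝ) (ht : 0 ≤ t)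
    (hd : Metric.infDist g {y | mergeVec I 0 y ∈ K} < t) :
    ∑ i, g i ^ 2 - ∑ i ∈ I, g i ^ 2 - ‖g‖ * t ≤ ∑ i, |g i| := by
  obtain ⟨y, hy, hgy⟩ := (Metric.infDist_lt_iff hne).1 hd
  have h1 : ⟪g, mergeVec I 0 y⟫ ≤ ⟪g, x⟫ := by
    refine local_max K hconv g x _ hx hmax hy ?_
    intro i hi
    simp [mergeVec_apply, hI i hi]
  have h2 := inner_le_l1 g x hx.2
  have h3 : ⟪g, mergeVec I 0 y⟫ = ⟪mergeVec I 0 g, y⟫ := by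
    rw [inner_coord, inner_coord]
    apply Finset.sum_congr rfl
    intro i _
    by_cases hi : i ∈ I <;> simp [mergeVec_apply, hi]
  have h4 : ⟪mergeVec I 0 g, y⟫ = ⟪mergeVec I 0 g, g⟫ - ⟪mergeVec I 0 g, g - y⟫ := by
    rw [inner_sub_right]; ring
  have h5 : ⟪mergeVec I 0 g, g⟫ = ∑ i, g i ^ 2 - ∑ i ∈ I, g i ^ 2 := by
    rw [inner_coord, ← Finset.sum_filter_add_sum_filter_not Finset.univ (· ∈ I) (fun i => g i ^ 2),
      Finset.filter_mem_eq_inter, Finset.univ_inter, add_sub_cancel_left, Finset.sum_filter]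
    apply Finset.sum_congr rfl
    intro i _
    by_cases hi : i ∈ I
    · simp [mergeVec_apply, hi]
    · simp [mergeVec_apply, hi, sq]
  have h6 : ‖mergeVec I 0 g‖ ≤ ‖g‖ := by
    rw [EuclideanSpace.norm_eq, EuclideanSpace.norm_eq]
    apply Real.sqrt_le_sqrt
    apply Finset.sum_le_sum
    intro i _
    by_cases hi : i ∈ I
    · simp [mergeVec_apply, hi]; positivity
    · simp [mergeVec_apply, hi]
  have h7 : ⟪mergeVec I 0 g, g - y⟫ ≤ ‖g‖ * t := by
    refine (real_inner_le_norm _ _).trans ?_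
    rw [dist_eq_norm] at hgy
    exact mul_le_mul h6 hgy.le (norm_nonneg _) (norm_nonneg _)
  linarith


open ProbabilityTheory in
theorem gauss1_abs_pow (k : ℕ) : ∫ x, |x| ^ k ∂(gaussianReal 0 1) =
    √(2 / π) * 2 ^ (((k : ℝ) + 1) / 2) * (1 / 2) * Real.Gamma (((k : ℝ) + 1) / 2) := by
  rw [integral_gaussianReal_eq_integral_smul (by norm_num)]
  have h1 : ∀ x : ℝ, gaussianPDFReal 0 1 x • |x| ^ k =
      (fun y : ℝ => (√(2 * π))⁻¹ * (y ^ (k : ℝ) * Real.exp (-(1 / 2) * y ^ (2 : ℝ)))) |x| := by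
    intro x
    simp only [gaussianPDFReal, smul_eq_mul, Real.rpow_natCast, NNReal.coe_one, mul_one, sub_zero]
    have : (|x|) ^ (2 : ℝ) = x ^ 2 := by
      rw [← sq_abs x]; exact_mod_cast Real.rpow_natCast _ 2
    rw [this]
    have : -x ^ 2 / 2 = -(1 / 2) * x ^ 2 := by ring
    rw [this]
    ring
  rw [integral_congr_ae (Filter.Eventually.of_forall h1)]
  rw [integral_comp_abs (f := fun y : ℝ =>
      (√(2 * π))⁻¹ * (y ^ (k : ℝ) * Real.exp (-(1 / 2) * y ^ (2 : ℝ)))), integral_const_mul,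
    integral_rpow_mul_exp_neg_mul_rpow (by norm_num) (by
      have : (0 : ℝ) ≤ k := by positivity
      linarith) (by norm_num)]
  have h2 : (1 / 2 : ℝ) ^ (-((k : ℝ) + 1) / 2) = 2 ^ (((k : ℝ) + 1) / 2) := by
    rw [neg_div, Real.rpow_neg (by norm_num), ← Real.inv_rpow (by norm_num)]
    norm_num
  rw [h2]
  have h3 : 2 * (√(2 * π))⁻¹ = √(2 / π) := by
    rw [Real.sqrt_mul (by norm_num), Real.sqrt_div (by norm_num)]
    have : √(2 : ℝ) ^ 2 = 2 := Real.sq_sqrt (by norm_num)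
    have h0 : 0 < √(2 : ℝ) := by positivity
    have h00 : 0 < √π := Real.sqrt_pos.2 Real.pi_pos
    field_simp
    linarith
  rw [← h3]
  ring

open ProbabilityTheory in
theorem gauss1_abs_pow_integrable (k : ℕ) : Integrable (fun x : ℝ => |x| ^ k) (gaussianReal 0 1) := by
  have h := (memLp_id_gaussianReal (μ := 0) (v := 1) (k : NNReal)).integrable_norm_pow'
  simpa using h

open ProbabilityTheory in
theorem gauss1_m1 : ∫ x, |x| ∂(gaussianReal 0 1) = √(2 / π) := by
  have := gauss1_abs_pow 1
  simp only [pow_one] at this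
  rw [this]
  have e : (((1 : ℕ) : ℝ) + 1) / 2 = 1 := by norm_num
  rw [e, Real.Gamma_one, Real.rpow_one]
  ring

open ProbabilityTheory in
theorem gauss1_m3 : ∫ x, |x| ^ 3 ∂(gaussianReal 0 1) = 2 * √(2 / π) := by
  have := gauss1_abs_pow 3
  rw [this]
  have e : ((3 : ℕ) : ℝ) + 1 = 4 := by norm_num
  have e2 : (4 : ℝ) / 2 = 2 := by norm_num
  rw [e, e2, Real.Gamma_two]
  have : (2 : ℝ) ^ (2 : ℝ) = 4 := by norm_num
  rw [this]
  ring

theorem sqrt_aux : √(2 / π) * (2 : ℝ) ^ (1 / 2 : ℝ) * √π = 2 := by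
  have h1 : (2 : ℝ) ^ (1 / 2 : ℝ) = √2 := (Real.sqrt_eq_rpow 2).symm
  rw [h1, ← Real.sqrt_mul (by positivity), ← Real.sqrt_mul (by positivity)]
  have hpi := Real.pi_ne_zero
  have : 2 / π * 2 * π = 2 ^ 2 := by field_simp
  rw [this, Real.sqrt_sq (by norm_num)]

open ProbabilityTheory in
theorem gauss1_m2 : ∫ x, |x| ^ 2 ∂(gaussianReal 0 1) = 1 := by
  rw [gauss1_abs_pow 2]
  have e : (((2 : ℕ) : ℝ) + 1) / 2 = 1 / 2 + 1 := by norm_num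
  rw [e, Real.Gamma_add_one (by norm_num), Real.Gamma_one_half_eq, Real.rpow_add (by norm_num), Real.rpow_one]
  linear_combination (1 / 2) * sqrt_aux

open ProbabilityTheory in
theorem gauss1_m4 : ∫ x, |x| ^ 4 ∂(gaussianReal 0 1) = 3 := by
  rw [gauss1_abs_pow 4]
  have e : (((4 : ℕ) : ℝ) + 1) / 2 = 1 / 2 + 1 + 1 := by norm_num
  rw [e, Real.Gamma_add_one (by norm_num), Real.Gamma_add_one (by norm_num), Real.Gamma_one_half_eq,
    Real.rpow_add (by norm_num), Real.rpow_add (by norm_num), Real.rpow_one]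
  linear_combination (3 / 2) * sqrt_aux

/-- The one-dimensional function whose sum controls the gap. -/
noncomputable def xiFun (x : ℝ) : ℝ := x ^ 2 - |x|

theorem xiFun_eq (x : ℝ) : xiFun x = |x| ^ 2 - |x| := by simp [xiFun]

theorem xiFun_cont : Continuous xiFun := by unfold xiFun; fun_prop

theorem xiFun_sq (x : ℝ) : xiFun x ^ 2 = |x| ^ 4 - 2 * |x| ^ 3 + |x| ^ 2 := by
  rw [xiFun_eq]; ring

open ProbabilityTheory in
theorem xi_mean : ∫ x, xiFun x ∂(gaussianReal 0 1) = 1 - √(2 / π) := by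
  simp only [xiFun_eq]
  have h1 := gauss1_abs_pow_integrable 1
  simp only [pow_one] at h1
  rw [integral_sub (gauss1_abs_pow_integrable 2) h1, gauss1_m2, gauss1_m1]

open ProbabilityTheory in
theorem xi_memLp : MemLp xiFun 2 (gaussianReal 0 1) := by
  rw [memLp_two_iff_integrable_sq xiFun_cont.aestronglyMeasurable]
  simp only [xiFun_sq]
  exact ((gauss1_abs_pow_integrable 4).sub ((gauss1_abs_pow_integrable 3).const_mul 2)).add
    (gauss1_abs_pow_integrable 2)

open ProbabilityTheory in
theorem xi_var : Var[xiFun; gaussianReal 0 1] = (1 - √(2 / π)) * (3 + √(2 / π)) := by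
  rw [variance_eq_sub xi_memLp, xi_mean]
  have : ∫ x, (xiFun ^ 2) x ∂(gaussianReal 0 1) = 4 - 4 * √(2 / π) := by
    simp only [Pi.pow_apply, xiFun_sq]
    have hi : Integrable (fun x : ℝ => |x| ^ 4 - 2 * |x| ^ 3) (gaussianReal 0 1) :=
      (gauss1_abs_pow_integrable 4).sub ((gauss1_abs_pow_integrable 3).const_mul 2)
    rw [integral_add hi
      (gauss1_abs_pow_integrable 2), integral_sub (gauss1_abs_pow_integrable 4)
      ((gauss1_abs_pow_integrable 3).const_mul 2), integral_const_mul, gauss1_m2, gauss1_m3, gauss1_m4]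
    ring
  rw [this]
  ring

open ProbabilityTheory in
theorem cantelli {Ω : Type*} [MeasurableSpace Ω] (μ : Measure Ω) [IsProbabilityMeasure μ]
    (X : Ω → ℝ) (hX : MemLp X 2 μ) (s : ℝ) (hs : 0 < s) :
    μ.real {ω | X ω ≤ μ[X] - s} ≤ Var[X; μ] / (Var[X; μ] + s ^ 2) := by
  set v := Var[X; μ] with hv
  have hv0 : 0 ≤ v := variance_nonneg _ _
  set m := μ[X] with hm
  have hXi : Integrable X μ := hX.integrable (by norm_num)
  have hX2 : Integrable (fun ω => X ω ^ 2) μ := hX.integrable_sq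
  have hvar : ∫ ω, X ω ^ 2 ∂μ = v + m ^ 2 := by
    have := variance_eq_sub hX
    simp only [Pi.pow_apply] at this
    linarith
  set c := v / s with hc
  have hc0 : 0 ≤ c := by positivity
  have hintg : Integrable (fun ω => (X ω - (m + c)) ^ 2) μ := by
    have : (fun ω => (X ω - (m + c)) ^ 2) = fun ω => X ω ^ 2 - 2 * (m + c) * X ω + (m + c) ^ 2 := by
      ext; ring
    rw [this]
    exact (hX2.sub (hXi.const_mul _)).add (integrable_const _)
  have hval : ∫ ω, (X ω - (m + c)) ^ 2 ∂μ = v + c ^ 2 := by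
    have : (fun ω => (X ω - (m + c)) ^ 2) = fun ω => X ω ^ 2 - 2 * (m + c) * X ω + (m + c) ^ 2 := by
      ext; ring
    have hi : Integrable (fun ω => X ω ^ 2 - 2 * (m + c) * X ω) μ := hX2.sub (hXi.const_mul _)
    rw [this, integral_add hi (integrable_const _),
      integral_sub hX2 (hXi.const_mul _), integral_const_mul, hvar, ← hm]
    simp
    ring
  have hmar := mul_meas_ge_le_integral_of_nonneg (μ := μ)
    (f := fun ω => (X ω - (m + c)) ^ 2) (Filter.Eventually.of_forall fun ω => sq_nonneg _) hintg
    ((s + c) ^ 2)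
  rw [hval] at hmar
  have hsub : {ω | X ω ≤ m - s} ⊆ {ω | (s + c) ^ 2 ≤ (X ω - (m + c)) ^ 2} := by
    intro ω hω
    simp only [Set.mem_ofPred_eq] at hω ⊢
    nlinarith
  have h1 : μ.real {ω | X ω ≤ m - s} ≤ μ.real {ω | (s + c) ^ 2 ≤ (X ω - (m + c)) ^ 2} :=
    measureReal_mono hsub
  have hsc : 0 < (s + c) ^ 2 := by positivity
  have h2 : μ.real {ω | X ω ≤ m - s} ≤ (v + c ^ 2) / (s + c) ^ 2 := by
    rw [le_div_iff₀ hsc]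
    nlinarith
  refine h2.trans (le_of_eq ?_)
  rw [hc]
  have : v + s ^ 2 ≠ 0 := by positivity
  have : s ^ 2 + v ≠ 0 := by positivity
  field_simp
  ring

theorem toLp_measurable (n : ℕ) :
    Measurable (WithLp.toLp 2 : (Fin n → ℝ) → EuclideanSpace ℝ (Fin n)) :=
  (PiLp.continuous_toLp 2 _).measurable

open ProbabilityTheory in
theorem gap_prob (n : ℕ) (s : ℝ) (hs : 0 < s) :
    (gauss n).real {g | ∑ i, xiFun (g i) ≤ n * (1 - √(2 / π)) - s} ≤
      (n * ((1 - √(2 / π)) * (3 + √(2 / π)))) / (n * ((1 - √(2 / π)) * (3 + √(2 / π))) + s ^ 2) := by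
  set P := Measure.pi (fun _ : Fin n => gaussianReal 0 1) with hP
  set X : (Fin n → ℝ) → ℝ := ∑ i, fun ω => xiFun (ω i) with hX
  have hXm : ∀ i : Fin n, MemLp (fun ω : Fin n → ℝ => xiFun (ω i)) 2 P := fun i =>
    xi_memLp.comp_measurePreserving (measurePreserving_eval (fun _ : Fin n => gaussianReal 0 1) i)
  have hmem : MemLp X 2 P := memLp_finsetSum' _ fun i _ => hXm i
  have hv : Var[X; P] = n * ((1 - √(2 / π)) * (3 + √(2 / π))) := by
    rw [hX, hP, variance_sum_pi (fun _ => xi_memLp)]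
    simp [xi_var]
  have hm : ∫ ω, X ω ∂P = n * (1 - √(2 / π)) := by
    simp only [hX, Finset.sum_apply]
    rw [integral_finsetSum _ fun i _ => (hXm i).integrable (by norm_num)]
    have : ∀ i : Fin n, ∫ ω : Fin n → ℝ, xiFun (ω i) ∂P = 1 - √(2 / π) := by
      intro i
      rw [hP, integral_comp_eval (μ := fun _ : Fin n => gaussianReal 0 1) (i := i)
        xiFun_cont.aestronglyMeasurable, xi_mean]
    rw [Finset.sum_congr rfl fun i _ => this i, Finset.sum_const, Finset.card_univ, Fintype.card_fin,
      nsmul_eq_mul]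
  have hc := cantelli P X hmem s hs
  rw [hv, hm] at hc
  refine le_trans (le_of_eq ?_) hc
  rw [gauss_eq_map, map_measureReal_apply (toLp_measurable n)]
  · congr 1
    ext ω
    simp [hX]
  · apply IsClosed.measurableSet
    refine isClosed_le (continuous_finsetSum _ fun i _ => xiFun_cont.comp (by fun_prop)) continuous_const

open ProbabilityTheory in
theorem four_prob (n : ℕ) (hn : 0 < n) :
    (gauss n).real {g | 100 * (n : ℝ) ≤ ∑ i, g i ^ 4} ≤ 0.03 := by
  set P := Measure.pi (fun _ : Fin n => gaussianReal 0 1) with hP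
  have hi4 : Integrable (fun x : ℝ => x ^ 4) (gaussianReal 0 1) := by
    have := gauss1_abs_pow_integrable 4
    refine this.congr (Filter.Eventually.of_forall fun x => ?_)
    exact Even.pow_abs (by decide) x
  have hm4 : ∫ x, x ^ 4 ∂(gaussianReal 0 1) = 3 := by
    rw [← gauss1_m4]
    congr 1
    ext x
    exact (Even.pow_abs (by decide) x).symm
  have hintg : ∀ i : Fin n, Integrable (fun ω : Fin n → ℝ => ω i ^ 4) P := fun i =>
    (measurePreserving_eval (fun _ : Fin n => gaussianReal 0 1) i).integrable_comp_of_integrable hi4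
  have hm : ∫ ω, ∑ i, ω i ^ 4 ∂P = n * 3 := by
    rw [integral_finsetSum _ fun i _ => hintg i]
    have : ∀ i : Fin n, ∫ ω : Fin n → ℝ, (ω i) ^ 4 ∂P = 3 := by
      intro i
      rw [hP, integral_comp_eval (μ := fun _ : Fin n => gaussianReal 0 1) (i := i)
        (f := fun x => x ^ 4) (by fun_prop), hm4]
    simp [this]
  have hmar := mul_meas_ge_le_integral_of_nonneg (μ := P)
    (f := fun ω => ∑ i, ω i ^ 4) (Filter.Eventually.of_forall fun ω =>
      Finset.sum_nonneg fun i _ => by positivity) (integrable_finsetSum _ fun i _ => hintg i)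
    (100 * n)
  rw [hm] at hmar
  have hn' : (0 : ℝ) < n := by exact_mod_cast hn
  rw [gauss_eq_map, map_measureReal_apply (toLp_measurable n)]
  · change P.real {ω | 100 * (n : ℝ) ≤ ∑ i, ω i ^ 4} ≤ 0.03
    by_contra hcon
    push Not at hcon
    nlinarith
  · apply IsClosed.measurableSet
    exact isClosed_le continuous_const (by fun_prop)


theorem a_bounds : 0.7978 ≤ √(2 / π) ∧ √(2 / π) ≤ 0.798 := by
  have h1 := Real.pi_gt_d4
  have h2 := Real.pi_lt_d4
  constructor
  · apply Real.le_sqrt_of_sq_le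
    rw [le_div_iff₀ Real.pi_pos]
    nlinarith
  · apply Real.sqrt_le_iff.2
    refine ⟨by norm_num, ?_⟩
    rw [div_le_iff₀ Real.pi_pos]
    nlinarith

theorem eps_bound (ε : ℝ) (hεu : ε < ((1 - Real.sqrt (2 / π)) / 32) ^ 4) : ε ≤ 0.0000000016 := by
  obtain ⟨h1, h2⟩ := a_bounds
  have : ((1 - Real.sqrt (2 / π)) / 32) ^ 4 ≤ (0.2022 / 32) ^ 4 := by
    apply pow_le_pow_left₀ (by linarith)
    linarith
  norm_num at this ⊢
  norm_num at hεu
  linarith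

open ProbabilityTheory in
theorem gaussianReal_Iic5 : gaussianReal 0 1 (Set.Iic (5 : ℝ)) ≤ ENNReal.ofReal (1 - 0.00000006) := by
  have hlow : 0.00000006 ≤ (gaussianReal 0 1).real (Set.Ioc (5 : ℝ) 5.2) := by
    rw [measureReal_def, gaussianReal_apply_eq_integral _ (by norm_num),
      ENNReal.toReal_ofReal (integral_nonneg fun x => gaussianPDFReal_nonneg _ _ _)]
    have hpdf : ∀ x ∈ Set.Ioc (5 : ℝ) 5.2, 0.0000003 ≤ gaussianPDFReal 0 1 x := by
      intro x hx
      have hx1 := hx.1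
      have hx2 := hx.2
      rw [gaussianPDFReal]
      have he : Real.exp (-14) ≤ Real.exp (-(x - 0) ^ 2 / (2 * ((1 : NNReal) : ℝ))) := by
        apply Real.exp_le_exp.2
        simp only [NNReal.coe_one]
        nlinarith
      have hs : √(2 * π * ((1 : NNReal) : ℝ)) ≤ 2.51 := by
        apply Real.sqrt_le_iff.2
        refine ⟨by norm_num, ?_⟩
        simp only [NNReal.coe_one]
        have := Real.pi_lt_d4
        linarith
      have hs0 : 0 < √(2 * π * ((1 : NNReal) : ℝ)) := by
        apply Real.sqrt_pos.2
        simp only [NNReal.coe_one]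
        positivity
      have hs' : (2.51 : ℝ)⁻¹ ≤ (√(2 * π * ((1 : NNReal) : ℝ)))⁻¹ := inv_anti₀ hs0 hs
      have he14 : (1 / 1210000 : ℝ) ≤ Real.exp (-14) := by
        rw [Real.exp_neg, one_div]
        apply inv_anti₀ (Real.exp_pos _)
        have h1 : Real.exp 14 = (Real.exp 1) ^ 14 := by
          rw [← Real.exp_nat_mul]; norm_num
        rw [h1]
        calc (Real.exp 1) ^ 14 ≤ (2.7183 : ℝ) ^ 14 :=
              pow_le_pow_left₀ (Real.exp_pos _).le (by linarith [Real.exp_one_lt_d9]) _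
          _ ≤ _ := by norm_num
      calc (0.0000003 : ℝ) ≤ (2.51 : ℝ)⁻¹ * (1 / 1210000 : ℝ) := by norm_num
        _ ≤ _ := mul_le_mul hs' (he14.trans he) (by norm_num) (by positivity)
    have := setIntegral_mono_on (μ := volume) (s := Set.Ioc (5 : ℝ) 5.2)
      (f := fun _ => (0.0000003 : ℝ)) (g := gaussianPDFReal 0 1)
      (integrableOn_const (by simp)) (integrable_gaussianPDFReal 0 1).integrableOn
      measurableSet_Ioc hpdf
    refine le_trans ?_ this
    rw [setIntegral_const]
    simp
    norm_num
  have hle : (gaussianReal 0 1).real (Set.Iic (5 : ℝ)) ≤ 1 - 0.00000006 := by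
    have hdisj : Disjoint (Set.Iic (5 : ℝ)) (Set.Ioc (5 : ℝ) 5.2) := by
      rw [Set.disjoint_left]
      intro x hx hx2
      exact absurd hx2.1 (not_lt.2 hx)
    have h1 := measureReal_union (μ := gaussianReal 0 1) hdisj measurableSet_Ioc
    have h2 : (gaussianReal 0 1).real (Set.Iic (5 : ℝ) ∪ Set.Ioc (5 : ℝ) 5.2) ≤ 1 :=
      measureReal_le_one
    linarith
  rw [← ofReal_measureReal]
  exact ENNReal.ofReal_le_ofReal hle

/-- The failure event when no coordinate is tight. -/
def failOne {n : ℕ} (K : Set (EuclideanSpace ℝ (Fin n))) : Set (EuclideanSpace ℝ (Fin n)) :=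
  {g | ∀ y ∈ K, ⟪g, y⟫ ≤ ∑ i, |g i|}

theorem l1_le_l2 {n : ℕ} (g : EuclideanSpace ℝ (Fin n)) : ∑ i, |g i| ≤ √n * ‖g‖ := by
  have h := sq_sum_le_card_mul_sum_sq (s := (Finset.univ : Finset (Fin n))) (f := fun i => |g i|)
  simp only [Finset.card_univ, Fintype.card_fin, sq_abs] at h
  rw [← EuclideanSpace.real_norm_sq_eq] at h
  refine (le_abs_self _).trans (abs_le_of_sq_le_sq ?_ (by positivity))
  rw [mul_pow, Real.sq_sqrt (by positivity)]
  exact h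

theorem small_regime {n : ℕ} (hn : 0 < n) (hn25 : n ≤ 25) (ε : ℝ) (hε : ε ≤ 0.0000000016)
    (K : Set (EuclideanSpace ℝ (Fin n)))
    (hm : ENNReal.ofReal (Real.exp (-ε * n)) ≤ gauss n K) :
    gauss n (failOne K) = 0 := by
  have hsub : failOne K ⊆ {0} := by
    intro g hg
    by_contra hg0
    have hg0 : g ≠ 0 := hg0
    have hpos : 0 < ‖g‖ := norm_pos_iff.2 hg0
    set u := ‖g‖⁻¹ • g with hu
    have hun : ‖u‖ = 1 := by
      rw [hu, norm_smul, norm_inv, norm_norm, inv_mul_cancel₀ hpos.ne']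
    have hs5 : √(n : ℝ) ≤ 5 := by
      apply Real.sqrt_le_iff.2
      refine ⟨by norm_num, ?_⟩
      have : (n : ℝ) ≤ 25 := by exact_mod_cast hn25
      linarith
    have hK : K ⊆ (fun w => ⟪u, w⟫) ⁻¹' (Set.Iic (5 : ℝ)) := by
      intro y hy
      have h1 : ⟪g, y⟫ ≤ 5 * ‖g‖ := by
        have := (hg y hy).trans (l1_le_l2 g)
        nlinarith
      simp only [Set.mem_preimage, Set.mem_Iic]
      rw [hu, real_inner_smul_left, inv_mul_le_iff₀ hpos]
      linarith
    have h2 : gauss n K ≤ ENNReal.ofReal (1 - 0.00000006) := by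
      refine (measure_mono hK).trans ?_
      rw [← Measure.map_apply (by fun_prop) measurableSet_Iic, gauss_map_inner]
      have : ‖u‖₊ = 1 := by ext; simpa using hun
      rw [this, one_pow]
      exact gaussianReal_Iic5
    have h3 := hm.trans h2
    rw [ENNReal.ofReal_le_ofReal_iff (by norm_num)] at h3
    have h4 := Real.add_one_le_exp (-ε * n)
    have h5 : (n : ℝ) ≤ 25 := by exact_mod_cast hn25
    have h6 : (0 : ℝ) < n := by exact_mod_cast hn
    nlinarith
  apply measure_mono_null hsub
  have : Nonempty (Fin n) := ⟨⟨0, hn⟩⟩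
  have hac : gauss n ≪ volume := withDensity_absolutelyContinuous _ _
  apply hac
  exact measure_singleton 0

theorem medium_regime {n : ℕ} (hn : 26 ≤ n) (hn2 : n ≤ 1000000) (ε : ℝ) (hε : ε ≤ 0.0000000016)
    (K : Set (EuclideanSpace ℝ (Fin n))) (hKm : MeasurableSet K)
    (hm : ENNReal.ofReal (Real.exp (-ε * n)) ≤ gauss n K) :
    (gauss n).real (failOne K) ≤ 1 / 2 := by
  obtain ⟨ha1, ha2⟩ := a_bounds
  have hn0 : (26 : ℝ) ≤ n := by exact_mod_cast hn
  have hn1 : (n : ℝ) ≤ 1000000 := by exact_mod_cast hn2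
  have hsub : failOne K ⊆ Kᶜ ∪ {g | ∑ i, xiFun (g i) ≤
      n * (1 - √(2 / π)) - n * (1 - √(2 / π))} := by
    intro g hg
    by_cases hgK : g ∈ K
    · right
      have := hg g hgK
      rw [inner_coord] at this
      simp only [Set.mem_ofPred_eq, xiFun, Finset.sum_sub_distrib, sub_self]
      simp only [← sq] at this
      linarith
    · left; exact hgK
  have h1 := gap_prob n (n * (1 - √(2 / π))) (by
    apply mul_pos <;> linarith)
  have h2 : (gauss n).real (failOne K) ≤ _ :=
    (measureReal_mono hsub).trans (measureReal_union_le _ _)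
  have h3 : (gauss n).real Kᶜ ≤ 0.0016 := by
    rw [probReal_compl_eq_one_sub hKm]
    have h4 : Real.exp (-ε * n) ≤ (gauss n).real K :=
      (ENNReal.ofReal_le_iff_le_toReal (measure_ne_top _ _)).1 hm
    have h5 := Real.add_one_le_exp (-ε * n)
    nlinarith
  have h4 : (n * ((1 - √(2 / π)) * (3 + √(2 / π)))) / (n * ((1 - √(2 / π)) * (3 + √(2 / π))) +
      (n * (1 - √(2 / π))) ^ 2) ≤ 0.45 := by
    set a := √(2 / π)
    have hb : 0 < n * (1 - a) := by apply mul_pos <;> linarith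
    have hv : 0 < n * ((1 - a) * (3 + a)) := by
      rw [← mul_assoc]
      have : 0 ≤ a := Real.sqrt_nonneg _
      apply mul_pos hb
      linarith
    rw [div_le_iff₀ (by positivity)]
    have e : 0.45 * (n * ((1 - a) * (3 + a)) + (n * (1 - a)) ^ 2) - n * ((1 - a) * (3 + a)) =
      n * (1 - a) * (0.45 * (n * (1 - a)) - 0.55 * (3 + a)) := by ring
    have : 0 ≤ n * (1 - a) * (0.45 * (n * (1 - a)) - 0.55 * (3 + a)) := by
      apply mul_nonneg hb.le
      nlinarith
    linarith
  linarith

theorem count_small (n : ℕ) :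
    ((Finset.univ.filter fun I : Finset (Fin n) => (I.card : ℝ) < 0.0000001 * n).card : ℝ) ≤
      Real.exp (0.0000112 * n) := by
  set T := Finset.univ.filter fun I : Finset (Fin n) => (I.card : ℝ) < 0.0000001 * n
  have hsum : ∑ I : Finset (Fin n), Real.exp (-12) ^ I.card = (Real.exp (-12) + 1) ^ n := by
    have := Finset.sum_pow_mul_eq_add_pow (Real.exp (-12)) 1 (Finset.univ : Finset (Fin n))
    simpa using this
  have h1 : (T.card : ℝ) * Real.exp (-0.0000012 * n) ≤ (Real.exp (-12) + 1) ^ n := by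
    rw [← hsum, ← nsmul_eq_mul, ← Finset.sum_const]
    calc _ ≤ ∑ I ∈ T, Real.exp (-12) ^ I.card := by
          apply Finset.sum_le_sum
          intro I hI
          have hI' : (I.card : ℝ) < 0.0000001 * n := (Finset.mem_filter.1 hI).2
          rw [← Real.exp_nat_mul]
          apply Real.exp_le_exp.2
          linarith
      _ ≤ _ := Finset.sum_le_sum_of_subset_of_nonneg (Finset.subset_univ _) fun I _ _ => by positivity
  have he12 : Real.exp (-12) ≤ 0.00001 := by
    rw [Real.exp_neg]
    have h1 : Real.exp 12 = (Real.exp 1) ^ 12 := by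
      rw [← Real.exp_nat_mul]; norm_num
    have h2 : (100000 : ℝ) ≤ Real.exp 12 := by
      rw [h1]
      calc (100000 : ℝ) ≤ 2.7 ^ 12 := by norm_num
        _ ≤ _ := pow_le_pow_left₀ (by norm_num) (by linarith [Real.exp_one_gt_d9]) _
    have := inv_anti₀ (by norm_num) h2
    norm_num at this ⊢
    linarith
  have h2 : (Real.exp (-12) + 1) ^ n ≤ Real.exp (0.00001 * n) := by
    have : Real.exp (0.00001 * n) = Real.exp 0.00001 ^ n := by
      rw [← Real.exp_nat_mul, mul_comm]
    rw [this]
    apply pow_le_pow_left₀ (by positivity)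
    have := Real.add_one_le_exp (0.00001 : ℝ)
    linarith
  have h3 : Real.exp (0.0000112 * n) * Real.exp (-0.0000012 * n) = Real.exp (0.00001 * n) := by
    rw [← Real.exp_add]; congr 1; ring
  have h4 := h1.trans h2
  rw [← h3] at h4
  exact le_of_mul_le_mul_right h4 (Real.exp_pos _)

/-- The general failure event. -/
def failGen {n : ℕ} (K : Set (EuclideanSpace ℝ (Fin n))) : Set (EuclideanSpace ℝ (Fin n)) :=
  {g | ∃ x ∈ K ∩ {y | ∀ i, |y i| ≤ 1},
    IsMaxOn (fun y => ⟪g, y⟫) (K ∩ {y | ∀ i, |y i| ≤ 1}) x ∧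
    ∃ I : Finset (Fin n), (∀ i, |x i| = 1 ↔ i ∈ I) ∧ (I.card : ℝ) < 0.0000001 * n}

theorem failGen_small {n : ℕ} (hn2 : n ≤ 1000000) (K : Set (EuclideanSpace ℝ (Fin n)))
    (hconv : Convex ℝ K) : failGen K ⊆ failOne K := by
  rintro g ⟨x, hx, hmax, I, hI, hcard⟩ y hy
  have hn1 : (n : ℝ) ≤ 1000000 := by exact_mod_cast hn2
  have h0 : I.card = 0 := by
    have : (I.card : ℝ) < 1 := by linarith
    have : I.card < 1 := by exact_mod_cast this
    omega
  rw [Finset.card_eq_zero] at h0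
  refine (local_max K hconv g x y hx hmax hy ?_).trans (inner_le_l1 g x hx.2)
  intro i hi
  have := (hI i).1 hi
  simp [h0] at this

theorem large_regime {n : ℕ} (hn : 1000000 < n) (ε : ℝ) (hε : ε ≤ 0.0000000016)
    (K : Set (EuclideanSpace ℝ (Fin n))) (hconv : Convex ℝ K) (hsymm : K = -K) (hcl : IsClosed K)
    (hne : K.Nonempty) (hm : ENNReal.ofReal (Real.exp (-ε * n)) ≤ gauss n K) :
    (gauss n).real (failGen K) ≤ 1 / 2 := by
  obtain ⟨ha1, ha2⟩ := a_bounds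
  have hn1 : (1000000 : ℝ) < n := by exact_mod_cast hn
  have hn0 : (0 : ℝ) < n := by linarith
  have hsq : √(n : ℝ) ^ 2 = n := Real.sq_sqrt hn0.le
  have hsq0 : 0 < √(n : ℝ) := Real.sqrt_pos.2 hn0
  have h0K : (0 : EuclideanSpace ℝ (Fin n)) ∈ K := by
    obtain ⟨z, hz⟩ := hne
    have hz' : -z ∈ K := by rw [hsymm]; simpa using hz
    have := hconv hz hz' (a := 1 / 2) (b := 1 / 2) (by norm_num) (by norm_num) (by norm_num)
    simpa using this
  set T := Finset.univ.filter fun I : Finset (Fin n) => (I.card : ℝ) < 0.0000001 * n with hT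
  set s := n * (1 - √(2 / π)) - 0.19 * n with hs
  have hs0 : 0.012 * n ≤ s := by rw [hs]; nlinarith
  set E1 : Set (EuclideanSpace ℝ (Fin n)) :=
    {g | ∑ i, xiFun (g i) ≤ n * (1 - √(2 / π)) - s} with hE1
  set E2 : Set (EuclideanSpace ℝ (Fin n)) := {g | 100 * (n : ℝ) ≤ ∑ i, g i ^ 4} with hE2
  set E3 : Finset (Fin n) → Set (EuclideanSpace ℝ (Fin n)) := fun I =>
    {x | 0.03 * √n ≤ Metric.infDist x {y | mergeVec I 0 y ∈ K}} with hE3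
  have hsub : failGen K ⊆ (E1 ∪ E2) ∪ ⋃ I ∈ T, E3 I := by
    rintro g ⟨x, hx, hmax, I, hI, hcard⟩
    by_contra hcon
    simp only [Set.mem_union, Set.mem_iUnion, not_or, not_exists] at hcon
    obtain ⟨⟨hc1, hc2⟩, hc3⟩ := hcon
    have hc3 := hc3 I (by simp [hT, hcard])
    simp only [hE1, hE2, hE3, Set.mem_ofPred_eq, not_le] at hc1 hc2 hc3
    have hL : {y | mergeVec I 0 y ∈ K}.Nonempty := by
      refine ⟨0, ?_⟩
      have : mergeVec I (0 : EuclideanSpace ℝ (Fin n)) 0 = 0 := by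
        ext i; simp [mergeVec_apply]
      simp only [Set.mem_ofPred_eq, this, h0K]
    have hd := det_large K hconv g x hx hmax I (fun i => (hI i).1) hL _ (by positivity) hc3
    have hxi : ∑ i, xiFun (g i) = ∑ i, g i ^ 2 - ∑ i, |g i| := by
      simp [xiFun, Finset.sum_sub_distrib]
    have h4I : ∑ i ∈ I, (g i ^ 2) ^ 2 ≤ ∑ i, g i ^ 4 := by
      calc _ ≤ ∑ i, (g i ^ 2) ^ 2 := Finset.sum_le_sum_of_subset_of_nonneg (Finset.subset_univ _)
            fun i _ _ => by positivity
        _ = _ := by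
          apply Finset.sum_congr rfl; intro i _; ring
    have hIsq : ∑ i ∈ I, g i ^ 2 ≤ 0.004 * n := by
      have h := sq_sum_le_card_mul_sum_sq (s := I) (f := fun i => g i ^ 2)
      refine (le_abs_self _).trans (abs_le_of_sq_le_sq ?_ (by positivity))
      have h' : (I.card : ℝ) * ∑ i ∈ I, (g i ^ 2) ^ 2 ≤ (0.0000001 * n) * (100 * n) :=
        mul_le_mul hcard.le (h4I.trans hc2.le) (Finset.sum_nonneg fun i _ => by positivity)
          (by positivity)
      nlinarith
    have hnorm : ‖g‖ ≤ 4 * √n := by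
      have h := sq_sum_le_card_mul_sum_sq (s := (Finset.univ : Finset (Fin n))) (f := fun i => g i ^ 2)
      have h4 : ∑ i, (g i ^ 2) ^ 2 = ∑ i, g i ^ 4 := by
        apply Finset.sum_congr rfl; intro i _; ring
      rw [h4, ← EuclideanSpace.real_norm_sq_eq, Finset.card_univ, Fintype.card_fin] at h
      have h5 : ‖g‖ ^ 2 ≤ 10 * n := by
        refine (le_abs_self _).trans (abs_le_of_sq_le_sq ?_ (by positivity))
        nlinarith
      refine (le_abs_self _).trans (abs_le_of_sq_le_sq ?_ (by positivity))
      rw [mul_pow, hsq]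
      linarith
    have hprod : ‖g‖ * (0.03 * √n) ≤ 0.12 * n := by
      calc ‖g‖ * (0.03 * √n) ≤ (4 * √n) * (0.03 * √n) :=
            mul_le_mul_of_nonneg_right hnorm (by positivity)
        _ = 0.12 * √n ^ 2 := by ring
        _ = _ := by rw [hsq]
    rw [hxi] at hc1
    linarith
  have p1 : (gauss n).real E1 ≤ 0.01 := by
    refine (gap_prob n s (by nlinarith)).trans ?_
    set v := (1 - √(2 / π)) * (3 + √(2 / π)) with hv
    have hv0 : 0 ≤ v := by apply mul_nonneg <;> linarith
    have hv1 : v ≤ 1 := by rw [hv]; nlinarith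
    have hss : (0.012 * n) ^ 2 ≤ s ^ 2 := pow_le_pow_left₀ (by positivity) hs0 2
    rw [div_le_iff₀ (by nlinarith)]
    nlinarith
  have p2 : (gauss n).real E2 ≤ 0.03 := four_prob n (by omega)
  have p3 : ∀ I, (gauss n).real (E3 I) ≤ 800 * Real.exp (-0.000049 * n) := by
    intro I
    have h := conc_section0 I K hconv hsymm hcl
    have hr : (gauss n).real K * (gauss n).real (E3 I) ≤ 800 * Real.exp (-0.00005 * n) := by
      have := ENNReal.toReal_mono ENNReal.ofReal_ne_top h
      rwa [ENNReal.toReal_mul, ENNReal.toReal_ofReal (by positivity)] at this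
    have h4 : Real.exp (-ε * n) ≤ (gauss n).real K :=
      (ENNReal.ofReal_le_iff_le_toReal (measure_ne_top _ _)).1 hm
    have h5 : Real.exp (-0.000001 * n) ≤ (gauss n).real K := by
      refine le_trans (Real.exp_le_exp.2 ?_) h4
      nlinarith
    have h6 : Real.exp (-0.000001 * n) * (gauss n).real (E3 I) ≤
        Real.exp (-0.000001 * n) * (800 * Real.exp (-0.000049 * n)) := by
      calc _ ≤ (gauss n).real K * (gauss n).real (E3 I) :=
            mul_le_mul_of_nonneg_right h5 measureReal_nonneg
        _ ≤ _ := hr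
        _ = 800 * (Real.exp (-0.000001 * n) * Real.exp (-0.000049 * n)) := by
          rw [← Real.exp_add]; congr 2; ring
        _ = _ := by ring
    exact le_of_mul_le_mul_left h6 (Real.exp_pos _)
  have p4 : (gauss n).real (⋃ I ∈ T, E3 I) ≤ 0.01 := by
    refine (measureReal_biUnion_finset_le T E3).trans ?_
    refine (Finset.sum_le_sum fun I _ => p3 I).trans ?_
    rw [Finset.sum_const, nsmul_eq_mul]
    calc (T.card : ℝ) * (800 * Real.exp (-0.000049 * n)) ≤
          Real.exp (0.0000112 * n) * (800 * Real.exp (-0.000049 * n)) :=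
          mul_le_mul_of_nonneg_right (count_small n) (by positivity)
      _ = 800 * (Real.exp (0.0000112 * n) * Real.exp (-0.000049 * n)) := by ring
      _ = 800 * Real.exp (-0.0000378 * n) := by
          rw [← Real.exp_add]; congr 2; ring
      _ ≤ 800 * Real.exp (-20) := by
          gcongr
          linarith
      _ ≤ 0.01 := by
          rw [Real.exp_neg]
          have h1 : Real.exp 20 = (Real.exp 1) ^ 20 := by
            rw [← Real.exp_nat_mul]; norm_num
          have h2 : (1000000 : ℝ) ≤ Real.exp 20 := by
            rw [h1]
            calc (1000000 : ℝ) ≤ 2 ^ 20 := by norm_num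
              _ ≤ _ := pow_le_pow_left₀ (by norm_num) (by linarith [Real.exp_one_gt_d9]) _
          have := inv_anti₀ (by norm_num) h2
          norm_num at this ⊢
          linarith
  have h1 : (gauss n).real (failGen K) ≤ _ :=
    (measureReal_mono hsub).trans ((measureReal_union_le _ _).trans
      (add_le_add (measureReal_union_le _ _) le_rfl))
  linarith

theorem fail_le {n : ℕ} (ε : ℝ) (hε : ε ≤ 0.0000000016)
    (K : Set (EuclideanSpace ℝ (Fin n))) (hconv : Convex ℝ K) (hsymm : K = -K) (hcl : IsClosed K)
    (hne : K.Nonempty) (hm : ENNReal.ofReal (Real.exp (-ε * n)) ≤ gauss n K) :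
    (gauss n).real (failGen K) ≤ 1 / 2 := by
  rcases Nat.eq_zero_or_pos n with h0 | h0
  · have : failGen K = ∅ := by
      ext g
      simp only [Set.mem_empty_iff_false, iff_false]
      rintro ⟨x, hx, hmax, I, hI, hcard⟩
      have h : (0 : ℝ) ≤ I.card := Nat.cast_nonneg _
      have hz : (n : ℝ) = 0 := by exact_mod_cast h0
      rw [hz] at hcard
      linarith
    rw [this]
    simp
  by_cases h1 : n ≤ 25
  · have := measure_mono_null (failGen_small (h1.trans (by norm_num)) K hconv) (small_regime h0 h1 ε hε K hm)
    rw [measureReal_def, this, ENNReal.toReal_zero]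
    norm_num
  by_cases h2 : n ≤ 1000000
  · exact (measureReal_mono (failGen_small h2 K hconv)).trans
      (medium_regime (by omega) h2 ε hε K hcl.measurableSet hm)
  exact large_regime (by omega) ε hε K hconv hsymm hcl hne hm


open scoped Classical in
theorem stmt10 (ε : ℝ) (hε : 0 < ε) (hεu : ε < ((1 - Real.sqrt (2 / π)) / 32) ^ 4) :
    ∃ δ : ℝ, 0 < δ ∧ ∀ (n : ℕ) (K : Set (EuclideanSpace ℝ (Fin n))),
      Convex ℝ K → K = -K → IsCompact K → K.Nonempty →
      ENNReal.ofReal (Real.exp (-ε * n)) ≤ gauss n K →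
      1 / 2 ≤ gauss n {g | ∀ x ∈ K ∩ {y | ∀ i, |y i| ≤ 1},
        -- `x` is a maximizer of `y ↦ ⟨g, y⟩` over `K ∩ [-1,1]ⁿ` ...
        IsMaxOn (fun y => ⟪g, y⟫) (K ∩ {y | ∀ i, |y i| ≤ 1}) x →
        -- ... of minimal norm (the tie-breaking rule for the argmax):
        (∀ x' ∈ K ∩ {y | ∀ i, |y i| ≤ 1},
            IsMaxOn (fun y => ⟪g, y⟫) (K ∩ {y | ∀ i, |y i| ≤ 1}) x' → ‖x‖ ≤ ‖x'‖) →
        δ * n ≤ (Finset.univ.filter fun i => |x i| = 1).card} := by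
  refine ⟨0.0000001, by norm_num, ?_⟩
  intro n K hconv hsymm hcomp hne hm
  have hfail := fail_le ε (eps_bound ε hεu) K hconv hsymm hcomp.isClosed hne hm
  set S := {g : EuclideanSpace ℝ (Fin n) | ∀ x ∈ K ∩ {y | ∀ i, |y i| ≤ 1},
        IsMaxOn (fun y => ⟪g, y⟫) (K ∩ {y | ∀ i, |y i| ≤ 1}) x →
        (∀ x' ∈ K ∩ {y | ∀ i, |y i| ≤ 1},
            IsMaxOn (fun y => ⟪g, y⟫) (K ∩ {y | ∀ i, |y i| ≤ 1}) x' → ‖x‖ ≤ ‖x'‖) →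
        0.0000001 * (n : ℝ) ≤ (Finset.univ.filter fun i => |x i| = 1).card} with hS
  have hcov : (Set.univ : Set (EuclideanSpace ℝ (Fin n))) ⊆ S ∪ failGen K := by
    intro g _
    by_cases hg : g ∈ S
    · exact Or.inl hg
    · right
      simp only [hS, Set.mem_ofPred_eq, not_forall, not_le] at hg
      obtain ⟨x, hx, hmax, _, hcard⟩ := hg
      exact ⟨x, hx, hmax, Finset.univ.filter fun i => |x i| = 1, by simp, hcard⟩
  have h1 : 1 ≤ (gauss n).real S + (gauss n).real (failGen K) := by
    have := (measureReal_mono (μ := gauss n) hcov).trans (measureReal_union_le _ _)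
    simpa using this
  have h2 : (1 / 2 : ℝ) ≤ (gauss n).real S := by linarith
  have h3 := (ENNReal.ofReal_le_iff_le_toReal (measure_ne_top (gauss n) S)).2 h2
  refine le_trans (le_of_eq ?_) h3
  rw [ENNReal.ofReal_div_of_pos (by norm_num)]
  simp
end

section
/- Let f(x) = e^{−x²/2 − V(x)} be a probability density with V convex, and let ε, α > 0 satisfy 4ε^{2/3} < α < (1/6)√(log(1/ε) − log(2π)). If the random variable X with density f satisfies |E[X]| < ε and Var[X] > 1 − ε, then max(f(α), f(−α)) > (1/√(2π)) e^{−2α²}. -/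
open MeasureTheory Real

/-- `f` has the form `f x = e^{-x²/2 - V x}` with `V : ℝ → ℝ ∪ {∞}` convex; equivalently,
`x ↦ f x · e^{x²/2}` is log-concave (the density is more log-concave than the Gaussian). -/
def RelLogConcave (f : ℝ → ℝ) : Prop :=
  ∀ x y a b : ℝ, 0 ≤ a → 0 ≤ b → a + b = 1 →
    (f x * Real.exp (x ^ 2 / 2)) ^ a * (f y * Real.exp (y ^ 2 / 2)) ^ b ≤
      f (a * x + b * y) * Real.exp ((a * x + b * y) ^ 2 / 2)


lemma exp_neg_le (v : ℝ) (hv : 0 ≤ v) : Real.exp (-v) ≤ 1 - v + v^2/2 := by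
  have h1 := Real.quadratic_le_exp_of_nonneg hv
  have h2 : Real.exp (-v) * Real.exp v = 1 := by rw [← Real.exp_add]; simp
  have h3 := Real.exp_pos (-v)
  have h4 : (0:ℝ) < 1 + v + v^2/2 := by positivity
  have h5 : Real.exp (-v) * (1 + v + v^2/2) ≤ 1 := by nlinarith
  have h6 : 1 ≤ (1 - v + v^2/2) * (1 + v + v^2/2) := by nlinarith [sq_nonneg (v^2)]
  exact le_of_mul_le_mul_right (h5.trans h6) h4

lemma int3 : IntegrableOn (fun u : ℝ => u^3 * Real.exp (-u^2)) (Set.Ioi 0) ∧ ∫ u in Set.Ioi (0:ℝ), u^3 * Real.exp (-u^2) = 1/2 := by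
  have h := integral_rpow_mul_exp_neg_rpow (p := 2) (q := 3) (by norm_num) (by norm_num)
  have h' := integrableOn_rpow_mul_exp_neg_rpow (s := 3) (p := 2) (by norm_num) (by norm_num)
  norm_num at h h'
  refine ⟨by simpa using h', ?_⟩
  rw [h]

lemma int4 : IntegrableOn (fun u : ℝ => u^4 * Real.exp (-u^2)) (Set.Ioi 0) ∧ ∫ u in Set.Ioi (0:ℝ), u^4 * Real.exp (-u^2) = 3 * √π / 8 := by
  have h := integral_rpow_mul_exp_neg_rpow (p := 2) (q := 4) (by norm_num) (by norm_num)
  have h' := integrableOn_rpow_mul_exp_neg_rpow (s := 4) (p := 2) (by norm_num) (by norm_num)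
  norm_num at h h'
  refine ⟨by simpa using h', ?_⟩
  rw [h]
  have := Real.Gamma_nat_add_half 2
  norm_num [Nat.doubleFactorial] at this
  rw [this]; ring

lemma int2 : IntegrableOn (fun u : ℝ => u^2 * Real.exp (-u^2)) (Set.Ioi 0) := by
  have h' := integrableOn_rpow_mul_exp_neg_rpow (s := 2) (p := 2) (by norm_num) (by norm_num)
  norm_num at h'
  simpa using h'

noncomputable def gg (x : ℝ) : ℝ := (√(2*π))⁻¹ * Real.exp (-x^2/2)

lemma gg_eq : gg = ProbabilityTheory.gaussianPDFReal 0 1 := by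
  ext x; simp [gg, ProbabilityTheory.gaussianPDFReal_def]

lemma gg_pos (x : ℝ) : 0 < gg x := by unfold gg; positivity
lemma gg_int : Integrable gg := by rw [gg_eq]; exact ProbabilityTheory.integrable_gaussianPDFReal 0 1
lemma gg_int1 : ∫ x, gg x = 1 := by
  rw [gg_eq]; exact ProbabilityTheory.integral_gaussianPDFReal_eq_one 0 one_ne_zero

lemma gg_x2 : Integrable (fun x => x^2 * gg x) := by
  have := (integrable_rpow_mul_exp_neg_mul_sq (b := 1/2) (by norm_num) (s := 2) (by norm_num)).const_mul (√(2*π))⁻¹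
  refine this.congr (Filter.Eventually.of_forall fun x => ?_)
  have e : x ^ (2:ℝ) = x ^ 2 := by exact_mod_cast Real.rpow_natCast x 2
  simp only [gg, e]
  rw [show -(1/2) * x^2 = -x^2/2 by ring]; ring

lemma gg_x1 : Integrable (fun x => x * gg x) := by
  have := (integrable_rpow_mul_exp_neg_mul_sq (b := 1/2) (by norm_num) (s := 1) (by norm_num)).const_mul (√(2*π))⁻¹
  refine this.congr (Filter.Eventually.of_forall fun x => ?_)
  simp only [gg, Real.rpow_one]
  rw [show -(1/2) * x^2 = -x^2/2 by ring]; ring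

lemma gg_m1 : ∫ x, x * gg x = 0 := by
  have := ProbabilityTheory.integral_id_gaussianReal (μ := 0) (v := 1)
  rw [ProbabilityTheory.integral_gaussianReal_eq_integral_smul one_ne_zero, ← gg_eq] at this
  simpa [mul_comm] using this

lemma gg_m2 : ∫ x, x^2 * gg x = 1 := by
  have := ProbabilityTheory.variance_id_gaussianReal (μ := 0) (v := 1)
  rw [ProbabilityTheory.variance_eq_integral (by fun_prop)] at this
  simp only [id, ProbabilityTheory.integral_id_gaussianReal] at this
  rw [ProbabilityTheory.integral_gaussianReal_eq_integral_smul one_ne_zero, ← gg_eq] at this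
  simpa [mul_comm] using this

lemma gg_exp (s a x : ℝ) : gg x * Real.exp (s * (x - a)) = Real.exp (s^2/2 - s*a) * gg (x - s) := by
  unfold gg
  rw [mul_assoc, mul_left_comm (Real.exp _), ← Real.exp_add, ← Real.exp_add]; ring_nf

noncomputable def GG (α : ℝ) (u : ℝ) : ℝ :=
  ((√(2*π))⁻¹ * Real.exp (-α^2)) * (u^2 * Real.exp (-u^2) * (1 - Real.exp (-(3*α/4*u))))

lemma GG_int (α : ℝ) (hα : 0 < α) : IntegrableOn (GG α) (Set.Ioi 0) := by
  unfold GG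
  refine Integrable.const_mul ?_ _
  refine Integrable.mono' int2 (by fun_prop) ?_
  refine (ae_restrict_iff' measurableSet_Ioi).2 (Filter.Eventually.of_forall fun u hu => ?_)
  have hu : 0 < u := hu
  have h1 : Real.exp (-(3*α/4*u)) ≤ 1 := Real.exp_le_one_iff.2 (by have := mul_pos hα hu; linarith)
  have h2 := Real.exp_pos (-(3*α/4*u))
  rw [Real.norm_of_nonneg (mul_nonneg (by positivity) (by linarith))]
  exact mul_le_of_le_one_right (by positivity) (by linarith)

lemma GG_low (α β : ℝ) (hα : 0 < α) (hβ : 0 ≤ β) (hβα : β ≤ 3*α/4) :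
    ((√(2*π))⁻¹ * Real.exp (-α^2)) * (β/2 - 3*√π/16 * β^2) ≤ ∫ u in Set.Ioi 0, GG α u := by
  unfold GG
  rw [integral_const_mul]
  refine mul_le_mul_of_nonneg_left ?_ (by positivity)
  have : β/2 - 3*√π/16 * β^2 = ∫ u in Set.Ioi (0:ℝ), (β * (u^3 * Real.exp (-u^2)) - β^2/2 * (u^4 * Real.exp (-u^2))) := by
    rw [integral_sub (int3.1.const_mul _) (int4.1.const_mul _), integral_const_mul, integral_const_mul, int3.2, int4.2]; ring
  rw [this]
  have hI := (GG_int α hα)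
  refine setIntegral_mono_on ((int3.1.const_mul _).sub (int4.1.const_mul _)) ?_ measurableSet_Ioi ?_
  · have := hI.const_mul ((√(2*π))⁻¹ * Real.exp (-α^2))⁻¹
    refine this.congr (Filter.Eventually.of_forall fun x => ?_)
    simp only [GG]
    rw [inv_mul_cancel_left₀]; positivity
  · intro u hu
    have hu : 0 < u := hu
    have h1 := exp_neg_le (β*u) (by positivity)
    have h2 : Real.exp (-(3*α/4*u)) ≤ Real.exp (-(β*u)) := Real.exp_le_exp.2 (by nlinarith)
    have h3 : 0 ≤ u^2 * Real.exp (-u^2) := by positivity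
    nlinarith [mul_le_mul_of_nonneg_left (h2.trans h1) h3]

lemma JJ (α ε : ℝ) (hε : 0 < ε) (hα : 0 < α)
    (hαl : 4 * ε ^ ((2 : ℝ) / 3) < α)
    (hαu : α < (1 / 6) * Real.sqrt (Real.log (1 / ε) - Real.log (2 * π))) :
    ε * (1 + 2*α) < ∫ u in Set.Ioi 0, GG α u := by
  have hπ := Real.pi_gt_d2
  have hπ' := Real.pi_lt_d2
  have hc : 0.398 ≤ (√(2*π))⁻¹ := by
    rw [le_inv_comm₀ (by norm_num) (by positivity), Real.sqrt_le_left (by norm_num)]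
    norm_num; linarith
  have hs : √π ≤ 1.775 := by
    rw [Real.sqrt_le_left (by norm_num)]; norm_num; linarith
  rcases le_total α (1/4) with h | h
  · refine lt_of_lt_of_le ?_ (GG_low α (3*α/4) hα (by positivity) le_rfl)
    have hε1 : ε ≤ α/16 := by
      have h1 : ε ^ ((2 : ℝ) / 3) ≤ α/4 := by linarith
      have h2 : (ε ^ ((2 : ℝ) / 3))^3 ≤ (α/4)^3 := pow_le_pow_left₀ (by positivity) h1 3
      have h3 : (ε ^ ((2 : ℝ) / 3))^3 = ε^2 := by
        rw [← Real.rpow_natCast, ← Real.rpow_mul hε.le, ← Real.rpow_natCast]; norm_num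
      rw [h3] at h2
      refine abs_le_of_sq_le_sq' ?_ (by positivity) |>.2
      nlinarith [sq_nonneg α]
    have he : 15/16 ≤ Real.exp (-α^2) := by
      have := Real.add_one_le_exp (-α^2)
      nlinarith
    have h3 : 0.373 ≤ (√(2*π))⁻¹ * Real.exp (-α^2) := by nlinarith
    have h4 : 0.43 * (3*α/4) ≤ (3*α/4)/2 - 3*√π/16 * (3*α/4)^2 := by nlinarith [mul_le_mul_of_nonneg_right hs (sq_nonneg α)]
    have h5 : 0.373 * (0.43 * (3*α/4)) ≤ ((√(2*π))⁻¹ * Real.exp (-α^2)) * ((3*α/4)/2 - 3*√π/16 * (3*α/4)^2) := mul_le_mul h3 h4 (by positivity) (by positivity)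
    nlinarith
  · refine lt_of_lt_of_le ?_ (GG_low α (3/16) hα (by positivity) (by linarith))
    have h1 : ε * (2*π) < Real.exp (-(36*α^2)) := by
      have h6 : 6 * α < Real.sqrt (Real.log (1 / ε) - Real.log (2 * π)) := by linarith
      rw [Real.lt_sqrt (by positivity)] at h6
      rw [← Real.log_lt_iff_lt_exp (by positivity), Real.log_mul hε.ne' (by positivity)]
      rw [one_div, Real.log_inv] at h6
      nlinarith
    have h2 : 1 + 2*α ≤ Real.exp (8*α^2) := by
      have := Real.add_one_le_exp (8*α^2)
      nlinarith
    have h3 : ε * (2*π) * (1+2*α) ≤ Real.exp (-(36*α^2)) * Real.exp (8*α^2) :=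
      mul_le_mul h1.le h2 (by positivity) (by positivity)
    have h4 : Real.exp (-(36*α^2)) * Real.exp (8*α^2) ≤ Real.exp (-α^2) * Real.exp (-(27/16)) := by
      rw [← Real.exp_add, ← Real.exp_add]
      exact Real.exp_le_exp.2 (by nlinarith)
    have h5 : Real.exp (-(27/16)) ≤ 1/5 := by
      have e1 := Real.exp_one_gt_d9
      have e2 := Real.quadratic_le_exp_of_nonneg (x := 11/16) (by norm_num)
      have e3 : Real.exp (27/16) = Real.exp 1 * Real.exp (11/16) := by rw [← Real.exp_add]; norm_num
      have e4 : 5 ≤ Real.exp (27/16) := by rw [e3]; nlinarith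
      rw [Real.exp_neg, one_div]
      exact inv_anti₀ (by norm_num) e4
    have hE := Real.exp_pos (-α^2)
    have h6 : 0.081 ≤ (3/16:ℝ)/2 - 3*√π/16 * (3/16)^2 := by linarith
    have h7 : (0.398 * Real.exp (-α^2)) * 0.081 ≤ ((√(2*π))⁻¹ * Real.exp (-α^2)) * ((3/16:ℝ)/2 - 3*√π/16 * (3/16)^2) := by
      gcongr
    have h8 : ε * (1+2*α) * 6.28 ≤ ε * (2*π) * (1+2*α) := by
      have : 0 < ε * (1+2*α) := by positivity
      nlinarith
    have h9 : Real.exp (-α^2) * Real.exp (-(27/16)) ≤ Real.exp (-α^2) * (1/5) := by gcongr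
    linarith

structure Dat (h : ℝ → ℝ) (ε : ℝ) : Prop where
  nn : ∀ x, 0 ≤ h x
  lc : ∀ x y a b : ℝ, 0 ≤ a → 0 ≤ b → a + b = 1 → h x ^ a * h y ^ b ≤ h (a * x + b * y)
  i0 : Integrable (fun x => gg x * h x)
  i1 : Integrable (fun x => x * (gg x * h x))
  i2 : Integrable (fun x => x^2 * (gg x * h x))
  e0 : ∫ x, gg x * h x = 1
  e1 : |∫ x, x * (gg x * h x)| < ε
  e2 : 1 - ε < ∫ x, x^2 * (gg x * h x)

namespace Dat
variable {h : ℝ → ℝ} {ε : ℝ}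

lemma mom (D : Dat h ε) (p q r : ℝ) :
    Integrable (fun x => (p * x^2 + q * x + r) * (gg x * (h x - 1))) ∧
    ∫ x, (p * x^2 + q * x + r) * (gg x * (h x - 1)) =
      p * ((∫ x, x^2 * (gg x * h x)) - 1) + q * ∫ x, x * (gg x * h x) := by
  have I2 := (D.i2.sub gg_x2).const_mul p
  have I1 := (D.i1.sub gg_x1).const_mul q
  have I0 := (D.i0.sub gg_int).const_mul r
  have E : (fun x => (p * x^2 + q * x + r) * (gg x * (h x - 1))) =
      fun x => (p * ((x^2 * (gg x * h x)) - x^2 * gg x) + q * ((x * (gg x * h x)) - x * gg x)) + r * (gg x * h x - gg x) := by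
    ext x; ring
  rw [E]
  refine ⟨(I2.add I1).add I0, ?_⟩
  have A1 := integral_add (I2.add I1) I0
  have A2 := integral_add I2 I1
  simp only [Pi.add_apply, Pi.sub_apply] at A1 A2
  rw [A1, A2, integral_const_mul, integral_const_mul, integral_const_mul, integral_sub D.i2 gg_x2,
    integral_sub D.i1 gg_x1, integral_sub D.i0 gg_int, gg_m2, gg_m1, gg_int1, D.e0]
  ring

/-- `h ≤ 1` a.e. and `h < 1` on a half line is impossible. -/
lemma not_le_one (D : Dat h ε) (a : ℝ) (h1 : ∀ x, x ≠ a → h x ≤ 1) (h2 : ∀ x < a, h x < 1) : False := by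
  have M := D.mom 0 0 (-1)
  have M1 : Integrable (fun x => gg x * (1 - h x)) := by
    refine M.1.congr (Filter.Eventually.of_forall fun x => ?_); simp; ring
  have M2 : ∫ x, gg x * (1 - h x) = 0 := by
    have := M.2
    simp only [zero_mul, zero_add] at this
    rw [← this]; congr 1; ext x; ring
  have hae : ∀ᵐ x : ℝ, x ≠ a := by simp [ae_iff]
  have nn : 0 ≤ᵐ[volume] fun x => gg x * (1 - h x) := by
    filter_upwards [hae] with x hx
    exact mul_nonneg (gg_pos x).le (by linarith [h1 x hx])
  have Z := (integral_eq_zero_iff_of_nonneg_ae nn M1).1 M2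
  have Z' : ∀ᵐ x : ℝ, ¬ x < a := by
    filter_upwards [Z] with x hx hxa
    have := mul_pos (gg_pos x) (sub_pos.2 (h2 x hxa))
    simp at hx
    rcases hx with hx | hx
    · exact (gg_pos x).ne' hx
    · linarith [h2 x hxa]
  rw [ae_iff] at Z'
  simp at Z'
  have : volume (Set.Iio a) = 0 := Z'
  simp at this

lemma nonempty (D : Dat h ε) : ∃ x, 1 ≤ h x := by
  by_contra! hc
  exact D.not_le_one 0 (fun x _ => (hc x).le) (fun x _ => hc x)

/-- three point form -/
lemma three (D : Dat h ε) {x z y : ℝ} (hxz : x < z) (hzy : z < y) :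
    h x ^ ((y-z)/(y-x)) * h y ^ ((z-x)/(y-x)) ≤ h z := by
  have hyx : 0 < y - x := by linarith
  have := D.lc x y ((y-z)/(y-x)) ((z-x)/(y-x)) (div_nonneg (by linarith) hyx.le)
    (div_nonneg (by linarith) hyx.le) (by field_simp; ring)
  rwa [show (y-z)/(y-x) * x + (z-x)/(y-x) * y = z by field_simp; ring] at this

lemma ordc (D : Dat h ε) {x z y : ℝ} (hxz : x ≤ z) (hzy : z ≤ y) (hx : 1 ≤ h x) (hy : 1 ≤ h y) : 1 ≤ h z := by
  rcases hxz.eq_or_lt with rfl | hxz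
  · exact hx
  rcases hzy.eq_or_lt with rfl | hzy
  · exact hy
  refine le_trans ?_ (D.three hxz hzy)
  exact one_le_mul_of_one_le_of_one_le (Real.one_le_rpow hx (div_nonneg (by linarith) (by linarith)))
    (Real.one_le_rpow hy (div_nonneg (by linarith) (by linarith)))

lemma three_log (D : Dat h ε) {x z y : ℝ} (hxz : x < z) (hzy : z < y) (hx : 0 < h x) (hy : 0 < h y) (hz : h z ≤ 1) :
    (y - z) * Real.log (h x) + (z - x) * Real.log (h y) ≤ 0 := by
  have hyx : 0 < y - x := by linarith
  have h1 := (D.three hxz hzy).trans hz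
  have h2 := Real.log_nonpos (by positivity) h1
  rw [Real.log_mul (by positivity) (by positivity), Real.log_rpow hx, Real.log_rpow hy] at h2
  have : ((y - z) * Real.log (h x) + (z - x) * Real.log (h y)) =
    (y-x) * ((y - z) / (y - x) * Real.log (h x) + (z - x) / (y - x) * Real.log (h y)) := by field_simp
  rw [this]
  exact mul_nonpos_of_nonneg_of_nonpos hyx.le h2

/-- supporting line at the left end `a` of `{1 ≤ h}` -/
lemma support (D : Dat h ε) {a x1 : ℝ} (hl : ∀ x < a, h x < 1) (hx1 : x1 < a) (hx1' : 0 < h x1) :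
    ∃ s, 0 ≤ s ∧ ∀ x, x ≠ a → h x ≤ Real.exp (s * (x - a)) := by
  have key : ∀ x < a, 0 < h x → ∀ y > a, 1 ≤ h y → Real.log (h y) / (y - a) ≤ - Real.log (h x) / (a - x) := by
    intro x hx hx' y hy hy'
    have : (y - a) * Real.log (h x) + (a - x) * Real.log (h y) ≤ 0 := by
      have ht : Filter.Tendsto (fun z => (y - z) * Real.log (h x) + (z - x) * Real.log (h y)) (nhdsWithin a (Set.Iio a))
          (nhds ((y - a) * Real.log (h x) + (a - x) * Real.log (h y))) := by
        refine Filter.Tendsto.mono_left (Continuous.tendsto ?_ a) nhdsWithin_le_nhds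
        fun_prop
      refine le_of_tendsto ht ?_
      have : Set.Ioo x a ∈ nhdsWithin a (Set.Iio a) := Ioo_mem_nhdsLT hx
      filter_upwards [this] with z hz
      exact D.three_log hz.1 (hz.2.trans hy) hx' (by linarith) (hl z hz.2).le
    rw [div_le_div_iff₀ (by linarith) (by linarith)]
    nlinarith
  set T : Set ℝ := (fun y => Real.log (h y) / (y - a)) '' {y | a < y ∧ 1 ≤ h y} with hT
  have hbdd : ∀ x < a, 0 < h x → ∀ t ∈ T, t ≤ - Real.log (h x) / (a - x) := by
    rintro x hx hx' _ ⟨y, hy, rfl⟩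
    exact key x hx hx' y hy.1 hy.2
  have hs0 : 0 ≤ sSup T := by
    apply Real.sSup_nonneg
    rintro _ ⟨y, hy, rfl⟩
    exact div_nonneg (Real.log_nonneg hy.2) (by linarith [hy.1])
  refine ⟨sSup T, hs0, fun x hx => ?_⟩
  rcases lt_or_gt_of_ne hx with hx | hx
  · rcases (D.nn x).eq_or_lt with h0 | h0
    · rw [← h0]; positivity
    · rw [← Real.log_le_iff_le_exp h0]
      have h1 : sSup T ≤ - Real.log (h x) / (a - x) := by
        apply Real.sSup_le (hbdd x hx h0)
        exact div_nonneg (by linarith [Real.log_nonpos h0.le (hl x hx).le]) (by linarith)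
      rw [le_div_iff₀ (by linarith)] at h1
      nlinarith
  · by_cases h1 : 1 ≤ h x
    · rw [← Real.log_le_iff_le_exp (by linarith), ← div_le_iff₀ (by linarith)]
      exact le_csSup ⟨_, hbdd x1 hx1 hx1'⟩ ⟨x, ⟨hx, h1⟩, rfl⟩
    · push Not at h1
      exact h1.le.trans (Real.one_le_exp (mul_nonneg hs0 (by linarith)))

lemma left_decay (D : Dat h ε) {a α : ℝ} (hα : 0 < α) (haα : α ≤ a) (hl : ∀ x < a, h x < 1) (u : ℝ) (hu : 0 < u) :
    h (-u) ≤ Real.exp (-(3*α/4*u)) := by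
  by_contra! hc
  obtain ⟨s, hs, hS⟩ := D.support hl (x1 := -u) (by linarith) ((Real.exp_pos _).trans hc)
  rcases hs.eq_or_lt with rfl | hs
  · exact D.not_le_one a (fun x hx => by simpa using hS x hx) hl
  have h1 := hc.trans_le (hS (-u) (by linarith))
  rw [Real.exp_lt_exp] at h1
  have hsα : s < α := by
    by_contra! h3
    nlinarith
  have hi : Integrable (fun x => gg x * Real.exp (s * (x - a))) := by
    simp only [gg_exp]
    exact (gg_int.comp_sub_right s).const_mul _
  have hv : ∫ x, gg x * Real.exp (s * (x - a)) = Real.exp (s^2/2 - s*a) := by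
    simp only [gg_exp]
    rw [integral_const_mul, integral_sub_right_eq_self gg s, gg_int1, mul_one]
  have hae : ∀ᵐ x : ℝ, x ≠ a := by simp [ae_iff]
  have := integral_mono_ae D.i0 hi (by
    filter_upwards [hae] with x hx
    exact mul_le_mul_of_nonneg_left (hS x hx) (gg_pos x).le)
  rw [hv, D.e0] at this
  have h4 : Real.exp (s^2/2 - s*a) < 1 := by rw [← Real.exp_zero]; exact Real.exp_lt_exp.2 (by nlinarith)
  linarith

lemma ind_right {α : ℝ} (hα : 0 < α) :
    Integrable (Set.indicator (Set.Ioi α) (fun x => GG α (x - α))) ∧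
    ∫ x, Set.indicator (Set.Ioi α) (fun x => GG α (x - α)) x = ∫ u in Set.Ioi 0, GG α u := by
  have e : Set.indicator (Set.Ioi α) (fun x => GG α (x - α)) = fun x => Set.indicator (Set.Ioi 0) (GG α) (x - α) := by
    ext x; simp [Set.indicator]
  have I : Integrable (Set.indicator (Set.Ioi 0) (GG α)) := (integrable_indicator_iff measurableSet_Ioi).2 (GG_int α hα)
  rw [e]
  refine ⟨I.comp_sub_right α, ?_⟩
  rw [integral_sub_right_eq_self (Set.indicator (Set.Ioi 0) (GG α)) α, integral_indicator measurableSet_Ioi]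

lemma ind_left {α : ℝ} (hα : 0 < α) :
    Integrable (Set.indicator (Set.Iio 0) (fun x => GG α (-x))) ∧
    ∫ x, Set.indicator (Set.Iio 0) (fun x => GG α (-x)) x = ∫ u in Set.Ioi 0, GG α u := by
  have e : Set.indicator (Set.Iio 0) (fun x => GG α (-x)) = fun x => Set.indicator (Set.Ioi 0) (GG α) (-x) := by
    ext x; simp [Set.indicator]
  have I : Integrable (Set.indicator (Set.Ioi 0) (GG α)) := (integrable_indicator_iff measurableSet_Ioi).2 (GG_int α hα)
  rw [e]
  refine ⟨I.comp_neg, ?_⟩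
  rw [integral_neg_eq_self (Set.indicator (Set.Ioi 0) (GG α)), integral_indicator measurableSet_Ioi]

lemma GG_left {α u : ℝ} (hα : 0 < α) (hu : 0 < u) {k : ℝ} (hk : k ≤ Real.exp (-(3*α/4*u))) :
    GG α u ≤ u * (gg (-u) * (1 - k)) ∧ GG α u ≤ u^2 * (gg (-u) * (1 - k)) := by
  have h1 : Real.exp (-(3*α/4*u)) ≤ 1 := Real.exp_le_one_iff.2 (by have := mul_pos hα hu; linarith)
  have h2 : 0 ≤ 1 - Real.exp (-(3*α/4*u)) := by linarith
  have hc : 0 < (√(2*π))⁻¹ := by positivity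
  have ha : Real.exp (-α^2) ≤ 1 := Real.exp_le_one_iff.2 (by nlinarith)
  have hg : Real.exp (-u^2) ≤ Real.exp (-(-u)^2/2) := Real.exp_le_exp.2 (by nlinarith)
  have hg' : u * Real.exp (-u^2) ≤ Real.exp (-(-u)^2/2) := by
    have : Real.exp (-u^2) = Real.exp (-(-u)^2/2) * Real.exp (-(u^2/2)) := by rw [← Real.exp_add]; ring_nf
    rw [this]
    have h3 : u * Real.exp (-(u^2/2)) ≤ 1 := by
      rw [Real.exp_neg, ← div_eq_mul_inv, div_le_one (Real.exp_pos _)]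
      nlinarith [Real.add_one_le_exp (u^2/2), sq_nonneg (u-1)]
    nlinarith [Real.exp_pos (-(-u)^2/2)]
  have B : GG α u ≤ (√(2*π))⁻¹ * (u^2 * Real.exp (-u^2) * (1 - k)) := by
    unfold GG
    have : (√(2*π))⁻¹ * Real.exp (-α^2) ≤ (√(2*π))⁻¹ := mul_le_of_le_one_right hc.le ha
    gcongr
  have hk' : 0 ≤ 1 - k := by linarith
  constructor
  · refine B.trans ?_
    have : u^2 * Real.exp (-u^2) * (1-k) ≤ u * Real.exp (-(-u)^2/2) * (1-k) := by
      refine mul_le_mul_of_nonneg_right ?_ hk'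
      nlinarith
    calc _ ≤ (√(2*π))⁻¹ * (u * Real.exp (-(-u)^2/2) * (1-k)) := by gcongr
      _ = _ := by unfold gg; ring
  · refine B.trans ?_
    calc _ ≤ (√(2*π))⁻¹ * (u^2 * Real.exp (-(-u)^2/2) * (1-k)) := by gcongr
      _ = _ := by unfold gg; ring

lemma GG_right {α x : ℝ} (hα : 0 < α) (hx : α < x) {k : ℝ} (hk : k ≤ Real.exp (-(3*α/4*(x-α)))) :
    GG α (x - α) ≤ (x-α)^2 * (gg x * (1 - k)) := by
  have hu : 0 < x - α := by linarith
  have h1 : Real.exp (-(3*α/4*(x-α))) ≤ 1 := Real.exp_le_one_iff.2 (by have := mul_pos hα hu; linarith)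
  have h2 : 0 ≤ 1 - Real.exp (-(3*α/4*(x-α))) := by linarith
  have hg : Real.exp (-α^2) * Real.exp (-(x-α)^2) ≤ Real.exp (-x^2/2) := by
    rw [← Real.exp_add]
    exact Real.exp_le_exp.2 (by nlinarith [sq_nonneg (x - 2*α)])
  calc GG α (x-α) = (√(2*π))⁻¹ * ((x-α)^2 * (Real.exp (-α^2) * Real.exp (-(x-α)^2)) * (1 - Real.exp (-(3*α/4*(x-α))))) := by
        unfold GG; ring
    _ ≤ (√(2*π))⁻¹ * ((x-α)^2 * (Real.exp (-x^2/2)) * (1 - k)) := by gcongr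
    _ = _ := by unfold gg; ring

lemma sign (D : Dat h ε) {a b : ℝ} (hab : a ≤ b) (h1 : ∀ x < a, h x < 1) (h2 : ∀ x, b < x → h x < 1)
    (h3 : ∀ x, a < x → x < b → 1 ≤ h x) (x : ℝ) : 0 ≤ (x - a) * (b - x) * (gg x * (h x - 1)) := by
  have hg := (gg_pos x).le
  rcases lt_trichotomy x a with hx | rfl | hx
  · have := h1 x hx
    have e : (x - a) * (b - x) * (gg x * (h x - 1)) = (a - x) * (b - x) * (gg x * (1 - h x)) := by ring
    rw [e]
    exact mul_nonneg (mul_nonneg (by linarith) (by linarith)) (mul_nonneg hg (by linarith))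
  · simp
  rcases lt_trichotomy x b with hx' | rfl | hx'
  · have := h3 x hx hx'
    exact mul_nonneg (mul_nonneg (by linarith) (by linarith)) (mul_nonneg hg (by linarith))
  · simp
  · have := h2 x hx'
    have e : (x - a) * (b - x) * (gg x * (h x - 1)) = (x - a) * (x - b) * (gg x * (1 - h x)) := by ring
    rw [e]
    exact mul_nonneg (mul_nonneg (by linarith) (by linarith)) (mul_nonneg hg (by linarith))

lemma quad (D : Dat h ε) (a b : ℝ) : Integrable (fun x => (x - a) * (b - x) * (gg x * (h x - 1))) ∧
    ∫ x, (x - a) * (b - x) * (gg x * (h x - 1)) < ε + |a + b| * ε := by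
  have M := D.mom (-1) (a+b) (-(a*b))
  have e : (fun x => (x - a) * (b - x) * (gg x * (h x - 1))) =
    fun x => (-1 * x^2 + (a+b) * x + -(a*b)) * (gg x * (h x - 1)) := by ext x; ring
  rw [e]
  refine ⟨M.1, ?_⟩
  rw [M.2]
  have h1 := D.e2
  have h2 : (a + b) * ∫ x, x * (gg x * h x) ≤ |a + b| * ε := by
    refine (le_abs_self _).trans ?_
    rw [abs_mul]
    exact mul_le_mul_of_nonneg_left D.e1.le (abs_nonneg _)
  linarith

lemma caseA (D : Dat h ε) {α : ℝ} (hα : 0 < α) (hJ : ε * (1 + 2*α) < ∫ u in Set.Ioi 0, GG α u)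
    (hd : h α ≤ Real.exp (-(3*α^2/2))) (hS : ∀ x, 1 ≤ h x → -α < x ∧ x < α) : False := by
  obtain ⟨y0, hy0⟩ := D.nonempty
  set S := {x | 1 ≤ h x} with hSdef
  have hne : S.Nonempty := ⟨y0, hy0⟩
  have hba : BddAbove S := ⟨α, fun x hx => (hS x hx).2.le⟩
  have hbb : BddBelow S := ⟨-α, fun x hx => (hS x hx).1.le⟩
  have a1 : -α ≤ sInf S := le_csInf hne fun x hx => (hS x hx).1.le
  have b1 : sSup S ≤ α := csSup_le hne fun x hx => (hS x hx).2.le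
  have ab : sInf S ≤ sSup S := (csInf_le hbb hy0).trans (le_csSup hba hy0)
  have h1 : ∀ x < sInf S, h x < 1 := fun x hx => by
    by_contra! hc; exact absurd (csInf_le hbb hc) (not_le.2 hx)
  have h2 : ∀ x, sSup S < x → h x < 1 := fun x hx => by
    by_contra! hc; exact absurd (le_csSup hba hc) (not_le.2 hx)
  have h3 : ∀ x, sInf S < x → x < sSup S → 1 ≤ h x := fun x hx hx' => by
    obtain ⟨y, hy, hyx⟩ := exists_lt_of_csInf_lt hne hx
    obtain ⟨z, hz, hzx⟩ := exists_lt_of_lt_csSup hne hx'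
    exact D.ordc hyx.le hzx.le hy hz
  have tail : ∀ x, α < x → h x ≤ Real.exp (-(3*α/4*(x-α))) := by
    intro x hx
    rcases (D.nn x).eq_or_lt with h0 | h0
    · rw [← h0]; positivity
    have hy := hS y0 hy0
    have hp : 0 < (α - y0) / (x - y0) := div_pos (by linarith) (by linarith)
    have t := (D.three hy.2 hx).trans hd
    have t1 : h x ^ ((α - y0) / (x - y0)) ≤ Real.exp (-(3*α^2/2)) := by
      refine le_trans ?_ t
      exact le_mul_of_one_le_left (by positivity) (Real.one_le_rpow hy0 (div_nonneg (by linarith) (by linarith)))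
    rw [← Real.log_le_iff_le_exp (by positivity), Real.log_rpow h0, div_mul_eq_mul_div,
      div_le_iff₀ (by linarith)] at t1
    rw [← Real.log_le_iff_le_exp h0]
    by_contra! hc
    have q1 : 0 < α - y0 := by linarith
    have q2 : α - y0 < 2*α := by linarith
    have q3 : (α - y0) * (3*α/4*(x-α)) ≤ (2*α) * (3*α/4*(x-α)) := by
      apply mul_le_mul_of_nonneg_right q2.le
      have : 0 < x - α := by linarith
      positivity
    have q4 : (α - y0) * (-(3*α/4*(x-α))) < (α - y0) * Real.log (h x) := mul_lt_mul_of_pos_left hc q1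
    have q5 : 0 < α^2 * (α - y0) := by positivity
    nlinarith
  have Q := D.quad (sInf S) (sSup S)
  have R := ind_right hα
  have le := integral_mono R.1 Q.1 (fun x => by
    by_cases hx : α < x
    · rw [Set.indicator_of_mem (by exact hx)]
      refine (GG_right hα hx (tail x hx)).trans ?_
      have e : (x - sInf S) * (sSup S - x) * (gg x * (h x - 1)) = (x - sInf S) * (x - sSup S) * (gg x * (1 - h x)) := by ring
      simp only [e]
      have := h2 x (b1.trans_lt hx)
      refine mul_le_mul_of_nonneg_right ?_ (mul_nonneg (gg_pos x).le (by linarith))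
      rw [sq]
      exact mul_le_mul (by linarith) (by linarith) (by linarith) (by linarith)
    · rw [Set.indicator_of_notMem (by exact hx)]
      exact D.sign ab h1 h2 h3 x)
  rw [R.2] at le
  have hab : |sInf S + sSup S| ≤ 2 * α := abs_le.2 ⟨by linarith, by linarith⟩
  have hε : 0 < ε := (abs_nonneg _).trans_lt D.e1
  have := mul_le_mul_of_nonneg_right hab hε.le
  linarith [Q.2]

lemma caseB (D : Dat h ε) {α : ℝ} (hα : 0 < α) (hJ : ε * (1 + 2*α) < ∫ u in Set.Ioi 0, GG α u)
    (hS : ∀ x, 1 ≤ h x → α < x) : False := by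
  have hε : 0 < ε := (abs_nonneg _).trans_lt D.e1
  have hJ' : ε < ∫ u in Set.Ioi 0, GG α u := by nlinarith [mul_pos hε hα]
  obtain ⟨y0, hy0⟩ := D.nonempty
  set S := {x | 1 ≤ h x} with hSdef
  have hne : S.Nonempty := ⟨y0, hy0⟩
  have hbb : BddBelow S := ⟨α, fun x hx => (hS x hx).le⟩
  have a1 : α ≤ sInf S := le_csInf hne fun x hx => (hS x hx).le
  have h1 : ∀ x < sInf S, h x < 1 := fun x hx => by
    by_contra! hc; exact absurd (csInf_le hbb hc) (not_le.2 hx)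
  have L := ind_left hα
  have dec := D.left_decay hα a1 h1
  by_cases hba : BddAbove S
  · have ab : sInf S ≤ sSup S := (csInf_le hbb hy0).trans (le_csSup hba hy0)
    have h2 : ∀ x, sSup S < x → h x < 1 := fun x hx => by
      by_contra! hc; exact absurd (le_csSup hba hc) (not_le.2 hx)
    have h3 : ∀ x, sInf S < x → x < sSup S → 1 ≤ h x := fun x hx hx' => by
      obtain ⟨y, hy, hyx⟩ := exists_lt_of_csInf_lt hne hx
      obtain ⟨z, hz, hzx⟩ := exists_lt_of_lt_csSup hne hx'
      exact D.ordc hyx.le hzx.le hy hz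
    have Q := D.quad (sInf S) (sSup S)
    have le := integral_mono (L.1.const_mul (1 + (sInf S + sSup S))) Q.1 (fun x => by
      by_cases hx : x < 0
      · simp only []
        rw [Set.indicator_of_mem (by exact hx)]
        have G := GG_left hα (neg_pos.2 hx) (dec (-x) (neg_pos.2 hx))
        rw [neg_neg] at G
        have hx1 := h1 x (by linarith)
        have hg : 0 ≤ gg x * (1 - h x) := mul_nonneg (gg_pos x).le (by linarith)
        have G1 := mul_le_mul_of_nonneg_left G.1 (show 0 ≤ sInf S + sSup S by linarith)
        have G2 : 0 ≤ sInf S * sSup S * (gg x * (1 - h x)) := mul_nonneg (mul_nonneg (by linarith) (by linarith)) hg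
        nlinarith [G.2]
      · simp only []
        rw [Set.indicator_of_notMem (by exact hx), mul_zero]
        exact D.sign ab h1 h2 h3 x)
    rw [integral_const_mul, L.2] at le
    have Q2 := Q.2
    have pos : 0 < sInf S + sSup S := by linarith
    rw [abs_of_pos pos] at Q2
    nlinarith
  · have h3 : ∀ x, sInf S < x → 1 ≤ h x := fun x hx => by
      obtain ⟨y, hy, hyx⟩ := exists_lt_of_csInf_lt hne hx
      rw [not_bddAbove_iff] at hba
      obtain ⟨z, hz, hzx⟩ := hba x
      exact D.ordc hyx.le hzx.le hy hz
    have M := D.mom 0 1 (-sInf S)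
    have le := integral_mono L.1 M.1 (fun x => by
      by_cases hx : x < 0
      · rw [Set.indicator_of_mem (by exact hx)]
        have G := GG_left hα (neg_pos.2 hx) (dec (-x) (neg_pos.2 hx))
        rw [neg_neg] at G
        have hx1 := h1 x (by linarith)
        have hg : 0 ≤ gg x * (1 - h x) := mul_nonneg (gg_pos x).le (by linarith)
        have G2 : 0 ≤ sInf S * (gg x * (1 - h x)) := mul_nonneg (by linarith) hg
        simp only []
        nlinarith [G.1]
      · rw [Set.indicator_of_notMem (by exact hx)]
        simp only [zero_mul, zero_add, one_mul]
        have hg := (gg_pos x).le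
        rcases lt_trichotomy x (sInf S) with hx | hx | hx
        · have := h1 x hx
          exact mul_nonneg_of_nonpos_of_nonpos (by linarith) (mul_nonpos_of_nonneg_of_nonpos hg (by linarith))
        · rw [hx]; simp
        · exact mul_nonneg (by linarith) (mul_nonneg hg (by linarith [h3 x hx])))
    rw [L.2, M.2] at le
    linarith [(abs_lt.1 D.e1).2]

lemma refl (D : Dat h ε) : Dat (fun x => h (-x)) ε := by
  have g : ∀ x, gg (-x) = gg x := fun x => by simp [gg]
  refine ⟨fun x => D.nn _, fun x y a b ha hb hab => ?_, ?_, ?_, ?_, ?_, ?_, ?_⟩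
  · have := D.lc (-x) (-y) a b ha hb hab
    rwa [show a * -x + b * -y = -(a*x+b*y) by ring] at this
  · simpa [g] using D.i0.comp_neg
  · simpa [g] using D.i1.comp_neg
  · simpa [g] using D.i2.comp_neg
  · have := integral_neg_eq_self (fun x => gg x * h x) volume
    rw [D.e0] at this; simpa [g] using this
  · have := integral_neg_eq_self (fun x => x * (gg x * h x)) volume
    have e := D.e1
    rw [← this] at e
    simpa [g, integral_neg] using e
  · have := integral_neg_eq_self (fun x => x^2 * (gg x * h x)) volume
    have e := D.e2
    rw [← this] at e
    simpa [g] using e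

lemma contra (D : Dat h ε) {α : ℝ} (hα : 0 < α) (hJ : ε * (1 + 2*α) < ∫ u in Set.Ioi 0, GG α u)
    (hd : h α ≤ Real.exp (-(3*α^2/2))) (hd' : h (-α) ≤ Real.exp (-(3*α^2/2))) : False := by
  have lt1 : Real.exp (-(3*α^2/2)) < 1 := by rw [← Real.exp_zero]; exact Real.exp_lt_exp.2 (by nlinarith)
  obtain ⟨y0, hy0⟩ := D.nonempty
  have nα : ¬ 1 ≤ h α := by linarith
  have nα' : ¬ 1 ≤ h (-α) := by linarith
  rcases lt_or_ge α y0 with c | c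
  · refine D.caseB hα hJ fun x hx => ?_
    by_contra! hc
    exact nα (D.ordc hc c.le hx hy0)
  rcases lt_or_ge y0 (-α) with c' | c'
  · refine D.refl.caseB hα hJ fun x hx => ?_
    by_contra! hc
    exact nα' (D.ordc c'.le (by linarith) hy0 hx)
  · refine D.caseA hα hJ hd fun x hx => ⟨?_, ?_⟩
    · by_contra! hc
      exact nα' (D.ordc hc c' hx hy0)
    · by_contra! hc
      exact nα (D.ordc c hc hy0 hx)

end Dat

theorem stmt16 (f : ℝ → ℝ) (hf0 : ∀ x, 0 ≤ f x) (hlc : RelLogConcave f)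
    (hint : ∫ x, f x = 1) (ε α : ℝ) (hε : 0 < ε)
    (hαl : 4 * ε ^ ((2 : ℝ) / 3) < α)
    (hαu : α < (1 / 6) * Real.sqrt (Real.log (1 / ε) - Real.log (2 * π)))
    (hE : |∫ x, x * f x| < ε)
    (hV : 1 - ε < ∫ x, (x - ∫ y, y * f y) ^ 2 * f x) :
    (1 / Real.sqrt (2 * π)) * Real.exp (-2 * α ^ 2) < max (f α) (f (-α)) := by
  by_contra! hcon
  have hα : 0 < α := lt_of_le_of_lt (by positivity) hαl
  have hJ := JJ α ε hε hα hαl hαu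
  have hε1 : ε < 1 := by
    have h6 : 0 < Real.sqrt (Real.log (1 / ε) - Real.log (2 * π)) := by linarith
    rw [Real.sqrt_pos, sub_pos] at h6
    have h7 := (Real.log_lt_log_iff (by positivity) (by positivity)).1 h6
    rw [lt_div_iff₀ hε] at h7
    nlinarith [Real.pi_gt_three]
  set m := ∫ y, y * f y with hm
  have hc : 0 < √(2*π) := by positivity
  have I0 : Integrable f := by
    by_contra hn
    rw [integral_undef hn] at hint; norm_num at hint
  have IV : Integrable (fun x => (x - m)^2 * f x) := by
    by_contra hn
    rw [integral_undef hn] at hV; linarith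
  have I1 : Integrable (fun x => x * f x) := by
    refine Integrable.mono' (IV.add (I0.const_mul (1 + |m|))) 
      (AEStronglyMeasurable.mul (by fun_prop) I0.1) (Filter.Eventually.of_forall fun x => ?_)
    simp only [Pi.add_apply]
    rw [norm_mul, Real.norm_eq_abs, Real.norm_of_nonneg (hf0 x), ← add_mul]
    refine mul_le_mul_of_nonneg_right ?_ (hf0 x)
    have h1 : |x| ≤ |x - m| + |m| := by simpa using abs_add_le (x - m) m
    have h2 : (x-m)^2 = |x - m|^2 := (sq_abs _).symm
    nlinarith [sq_nonneg (|x-m| - 1), abs_nonneg (x - m)]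
  have I2 : Integrable (fun x => x^2 * f x) := by
    have := (IV.add (I1.const_mul (2*m))).sub (I0.const_mul (m^2))
    refine this.congr (Filter.Eventually.of_forall fun x => ?_)
    simp only [Pi.add_apply, Pi.sub_apply]; ring
  have hV2 : ∫ x, (x - m)^2 * f x = (∫ x, x^2 * f x) - m^2 := by
    have e : (fun x => (x - m)^2 * f x) = fun x => (x^2 * f x - 2*m*(x * f x)) + m^2 * f x := by
      ext x; ring
    have A1 := integral_add (I2.sub (I1.const_mul (2*m))) (I0.const_mul (m^2))
    simp only [Pi.sub_apply] at A1
    rw [e, A1, integral_sub I2 (I1.const_mul (2*m)), integral_const_mul, integral_const_mul, hint, ← hm]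
    ring
  have key : ∀ x, gg x * (√(2*π) * (f x * Real.exp (x^2/2))) = f x := by
    intro x
    have : Real.exp (-x^2/2) * Real.exp (x^2/2) = 1 := by rw [← Real.exp_add]; ring_nf; simp
    unfold gg
    calc _ = ((√(2*π))⁻¹ * √(2*π)) * f x * (Real.exp (-x^2/2) * Real.exp (x^2/2)) := by ring
      _ = f x := by rw [this, inv_mul_cancel₀ hc.ne']; ring
  have D : Dat (fun x => √(2*π) * (f x * Real.exp (x^2/2))) ε := by
    refine ⟨fun x => mul_nonneg hc.le (mul_nonneg (hf0 x) (Real.exp_pos _).le), fun x y a b ha hb hab => ?_, ?_, ?_, ?_, ?_, ?_, ?_⟩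
    · have := hlc x y a b ha hb hab
      have nx : ∀ x, 0 ≤ f x * Real.exp (x^2/2) := fun x => mul_nonneg (hf0 x) (Real.exp_pos _).le
      rw [Real.mul_rpow hc.le (nx x), Real.mul_rpow hc.le (nx y)]
      have e : √(2*π) ^ a * √(2*π) ^ b = √(2*π) := by rw [← Real.rpow_add hc, hab, Real.rpow_one]
      calc _ = (√(2*π) ^ a * √(2*π) ^ b) * ((f x * Real.exp (x ^ 2 / 2)) ^ a * (f y * Real.exp (y ^ 2 / 2)) ^ b) := by ring
        _ ≤ _ := by rw [e]; exact mul_le_mul_of_nonneg_left this hc.le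
    · simpa only [key] using I0
    · simpa only [key] using I1
    · simpa only [key] using I2
    · simpa only [key] using hint
    · simpa only [key] using hE
    · simp only [key]
      nlinarith [sq_nonneg m]
  have fin : ∀ x, x^2 = α^2 → f x ≤ 1 / √(2*π) * Real.exp (-2*α^2) →
      √(2*π) * (f x * Real.exp (x^2/2)) ≤ Real.exp (-(3*α^2/2)) := by
    intro x hx hfx
    rw [hx]
    calc _ ≤ √(2*π) * ((1 / √(2*π) * Real.exp (-2*α^2)) * Real.exp (α^2/2)) := by gcongr
      _ = Real.exp (-2*α^2) * Real.exp (α^2/2) := by field_simp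
      _ = _ := by rw [← Real.exp_add]; ring_nf
  exact D.contra hα hJ (fin α rfl ((le_max_left _ _).trans hcon))
    (fin (-α) (by ring) ((le_max_right _ _).trans hcon))
end
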